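/- For every integer k ≥ 3 and every γ > 0 there exists an integer n₀ = n₀(k, γ) such that for every n ≥ n₀ divisible by k+1, every k-graph H on n vertices with δ_{k−1}(H) ≥ (1 − (k + ι_k)/(2k²) + γ)·n contains a K_{k+1}^k-factor, where ι_k = 1 if k is odd and ι_k = 0 if k is even. -/

import Mathlib

open Finset

/-- `A` is the vertex set of a copy of the hypergraph with vertex type `V` and edge set `EF`
inside the hypergraph on `Fin n` with edge set `E`. -/
def IsCopy {n : ℕ} {V : Type} [Fintype V] [DecidableEq V] (E : Finset (Finset (Fin n)))
    (EF : Finset (Finset V)) (A : Finset (Fin n)) : Prop :=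
  ∃ f : V ↪ Fin n, Finset.map f Finset.univ = A ∧ ∀ e ∈ EF, e.map f ∈ E

/-- The induced subhypergraph of `E` on `S` has an `F`-factor, where `F` has vertex type `V`
and edge set `EF`: there are pairwise vertex-disjoint copies of `F` covering exactly `S`. -/
def HasFactorOn {n : ℕ} {V : Type} [Fintype V] [DecidableEq V] (E : Finset (Finset (Fin n)))
    (EF : Finset (Finset V)) (S : Finset (Fin n)) : Prop :=
  ∃ P : Finset (Finset (Fin n)), (∀ A ∈ P, IsCopy E EF A) ∧
    (P : Set (Finset (Fin n))).PairwiseDisjoint id ∧ P.biUnion id = S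

/-- `x` is `(F, i, η)`-close to `y`. -/
def CloseTo {n : ℕ} {V : Type} [Fintype V] [DecidableEq V] (E : Finset (Finset (Fin n)))
    (EF : Finset (Finset V)) (i : ℕ) (η : ℝ) (x y : Fin n) : Prop :=
  η * (n : ℝ) ^ (i * Fintype.card V - 1) ≤
    (({S : Finset (Fin n) | S.card = i * Fintype.card V - 1 ∧ x ∉ S ∧ y ∉ S ∧
      HasFactorOn E EF (insert x S) ∧ HasFactorOn E EF (insert y S)}).ncard : ℝ)

/-- `H` is `(F, i, η)`-closed. -/
def IsClosedGraph {n : ℕ} {V : Type} [Fintype V] [DecidableEq V] (E : Finset (Finset (Fin n)))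
    (EF : Finset (Finset V)) (i : ℕ) (η : ℝ) : Prop :=
  ∀ x y : Fin n, x ≠ y → CloseTo E EF i η x y

/-- `Ñ_{F,i,η}(x)`: the set of vertices `(F, i, η)`-close to `x`. -/
def Ntilde {n : ℕ} {V : Type} [Fintype V] [DecidableEq V] (E : Finset (Finset (Fin n)))
    (EF : Finset (Finset V)) (i : ℕ) (η : ℝ) (x : Fin n) : Set (Fin n) :=
  {y | CloseTo E EF i η x y}

/-- Degree of the set `T` in the `k`-graph with edge set `E`. -/
noncomputable def degOn {n : ℕ} (E : Finset (Finset (Fin n))) (k : ℕ) (T : Finset (Fin n)) : ℕ :=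
  ({S : Finset (Fin n) | S.card = k - T.card ∧ Disjoint S T ∧ S ∪ T ∈ E}).ncard

/-- Edge set of the complete `k`-graph `K_t^k` on `Fin t`. -/
def cliqueEdges (t k : ℕ) : Finset (Finset (Fin t)) :=
  Finset.powersetCard k (Finset.univ : Finset (Fin t))

/-- Edge set of the complete `k`-partite `k`-graph `K_k^k(m)` with parts of size `m`. -/
def multipartiteEdges (k m : ℕ) : Finset (Finset (Fin k × Fin m)) :=
  Finset.univ.filter (fun e : Finset (Fin k × Fin m) =>
    ∀ i : Fin k, (e.filter (fun v => v.1 = i)).card = 1)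
namespace CliqueFactor

/-- The neighbourhood of `T`: vertices `v ∉ T` with `T ∪ {v}` an edge. -/
def nbr {n : ℕ} (E : Finset (Finset (Fin n))) (T : Finset (Fin n)) : Finset (Fin n) :=
  {v | v ∉ T ∧ insert v T ∈ E}

/-- `A` spans a complete `k`-graph on `k + 1` vertices. -/
def IsCliqueOn {n : ℕ} (E : Finset (Finset (Fin n))) (k : ℕ) (A : Finset (Fin n)) : Prop :=
  A.card = k + 1 ∧ ∀ e ⊆ A, e.card = k → e ∈ E

open Classical in
/-- The vertices extending `S` to a clique on `k + 1` vertices. -/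
noncomputable def cliqueExt {n : ℕ} (E : Finset (Finset (Fin n))) (k : ℕ)
    (S : Finset (Fin n)) : Finset (Fin n) :=
  {v | v ∉ S ∧ IsCliqueOn E k (insert v S)}

/-- `A` is partitioned into cliques on `k + 1` vertices. -/
def Tiled {n : ℕ} (E : Finset (Finset (Fin n))) (k : ℕ) (A : Finset (Fin n)) : Prop :=
  ∃ P : Finset (Finset (Fin n)), (∀ Q ∈ P, IsCliqueOn E k Q) ∧
    (P : Set (Finset (Fin n))).PairwiseDisjoint id ∧ P.biUnion id = A

/-- The asymptotic density of non-neighbours allowed by the codegree condition. -/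
noncomputable def codef (k : ℕ) (γ : ℝ) : ℝ := ((k : ℝ) + 1) / (2 * (k : ℝ) ^ 2) - γ

/-- A `k`-graph in which each `(k - 1)`-set has few non-neighbours. -/
def Dense {n : ℕ} (E : Finset (Finset (Fin n))) (k : ℕ) (γ : ℝ) : Prop :=
  (∀ e ∈ E, e.card = k) ∧
    ∀ T : Finset (Fin n), T.card + 1 = k → ((nbr E T)ᶜ.card : ℝ) ≤ codef k γ * n

open Classical in
/-- At least `c * n ^ m` of the `m`-sets satisfy `P`. -/
def Many {n : ℕ} (m : ℕ) (c : ℝ) (P : Finset (Fin n) → Prop) : Prop :=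
  c * (n : ℝ) ^ m ≤ (((Finset.powersetCard m Finset.univ).filter P).card : ℝ)

section Numerics

variable {k : ℕ} {γ : ℝ}

lemma mul_codef (hk : 3 ≤ k) : k * codef k γ = ((k : ℝ) + 1) / (2 * k) - k * γ := by
  have : (k : ℝ) ≠ 0 := by positivity
  unfold codef
  field_simp

lemma codef_le (hk : 3 ≤ k) (hγ : 0 ≤ γ) : codef k γ ≤ 2 / 9 := by
  have h3 : (3 : ℝ) ≤ k := by exact_mod_cast hk
  unfold codef
  have : ((k : ℝ) + 1) / (2 * (k : ℝ) ^ 2) ≤ 2 / 9 := by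
    rw [div_le_div_iff₀ (by positivity) (by norm_num)]
    nlinarith
  linarith

lemma mul_codef_le (hk : 3 ≤ k) (hγ : 0 ≤ γ) : k * codef k γ ≤ 2 / 3 := by
  have h3 : (3 : ℝ) ≤ k := by exact_mod_cast hk
  rw [mul_codef hk]
  have : ((k : ℝ) + 1) / (2 * k) ≤ 2 / 3 := by
    rw [div_le_div_iff₀ (by positivity) (by norm_num)]
    nlinarith
  have := mul_nonneg (by linarith : (0 : ℝ) ≤ k) hγ
  linarith

end Numerics

section Basic

variable {n k : ℕ} {E : Finset (Finset (Fin n))}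

lemma mem_nbr {T : Finset (Fin n)} {v : Fin n} : v ∈ nbr E T ↔ v ∉ T ∧ insert v T ∈ E := by
  simp [nbr]

lemma mem_cliqueExt {S : Finset (Fin n)} {v : Fin n} :
    v ∈ cliqueExt E k S ↔ v ∉ S ∧ IsCliqueOn E k (insert v S) := by
  simp [cliqueExt]

lemma mem_cliqueExt_insert_comm {T : Finset (Fin n)} (hT : T.card + 1 = k) {y z : Fin n}
    (hy : y ∈ nbr E T) (hz : z ∈ cliqueExt E k (insert y T)) :
    z ∈ nbr E T ∧ y ∈ cliqueExt E k (insert z T) := by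
  rw [mem_nbr] at *
  rw [mem_cliqueExt] at *
  obtain ⟨hz1, hz2, hz3⟩ := hz
  simp only [Finset.mem_insert, not_or] at hz1
  refine ⟨⟨hz1.2, hz3 _ ?_ ?_⟩, ?_, ?_⟩
  · exact Finset.insert_subset_insert _ (Finset.subset_insert _ _)
  · rw [Finset.card_insert_of_notMem hz1.2, hT]
  · simp only [Finset.mem_insert, not_or]
    exact ⟨fun h => hz1.1 h.symm, hy.1⟩
  · rw [Finset.insert_comm]
    exact ⟨hz2, hz3⟩

lemma mem_cliqueExt_of_forall_mem_nbr (hk : 2 ≤ k) {S : Finset (Fin n)} (hS : S ∈ E)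
    (hSk : S.card = k) {v : Fin n} (hv : ∀ s ∈ S, v ∈ nbr E (S.erase s)) :
    v ∈ cliqueExt E k S := by
  have hvS : v ∉ S := by
    intro hvS
    obtain ⟨s, hs, hsv⟩ := Finset.exists_mem_ne (by omega : 1 < S.card) v
    exact (mem_nbr.1 (hv s hs)).1 (Finset.mem_erase.2 ⟨hsv.symm, hvS⟩)
  refine mem_cliqueExt.2 ⟨hvS, by rw [Finset.card_insert_of_notMem hvS, hSk], ?_⟩
  intro e he hek
  by_cases hve : v ∈ e
  · have hsub : e.erase v ⊆ S := by
      intro a ha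
      have := he (Finset.mem_of_mem_erase ha)
      exact (Finset.mem_insert.1 this).resolve_left (Finset.ne_of_mem_erase ha)
    have hcard : (e.erase v).card + 1 = k := by rw [Finset.card_erase_add_one hve, hek]
    obtain ⟨s, hs, hse⟩ : ∃ s ∈ S, s ∉ e.erase v := by
      by_contra! h
      have := Finset.card_le_card (show S ⊆ e.erase v from h)
      omega
    have heq : e.erase v = S.erase s := by
      apply Finset.eq_of_subset_of_card_le
      · intro a ha
        exact Finset.mem_erase.2 ⟨fun h => hse (h ▸ ha), hsub ha⟩
      · rw [Finset.card_erase_of_mem hs]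
        omega
    have := (mem_nbr.1 (hv s hs)).2
    rwa [← heq, Finset.insert_erase hve] at this
  · have : e = S := Finset.eq_of_subset_of_card_le
      (fun a ha => (Finset.mem_insert.1 (he ha)).resolve_left (fun h => hve (h ▸ ha))) (by omega)
    exact this ▸ hS

lemma card_sdiff_cliqueExt_le (hk : 2 ≤ k) {S : Finset (Fin n)} (hS : S ∈ E)
    (hSk : S.card = k) (X : Finset (Fin n)) :
    (X \ cliqueExt E k S).card ≤ ∑ s ∈ S, (X \ nbr E (S.erase s)).card := by
  refine le_trans (Finset.card_le_card ?_) Finset.card_biUnion_le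
  intro v hv
  rw [Finset.mem_sdiff] at hv
  by_contra h
  simp only [Finset.mem_biUnion, Finset.mem_sdiff, not_exists, not_and, not_not] at h
  exact hv.2 (mem_cliqueExt_of_forall_mem_nbr hk hS hSk fun s hs => h s hs hv.1)

lemma Dense.card_sdiff_nbr_le {γ : ℝ} (hE : Dense E k γ) {T : Finset (Fin n)}
    (hT : T.card + 1 = k) (X : Finset (Fin n)) :
    ((X \ nbr E T).card : ℝ) ≤ codef k γ * n := by
  refine le_trans ?_ (hE.2 T hT)
  exact_mod_cast Finset.card_le_card fun v hv => by simp at hv ⊢; exact hv.2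

lemma Dense.card_sdiff_cliqueExt_le {γ : ℝ} (hE : Dense E k γ) (hk : 2 ≤ k)
    {S : Finset (Fin n)} (hS : S ∈ E) (X : Finset (Fin n)) :
    ((X \ cliqueExt E k S).card : ℝ) ≤ k * codef k γ * n := by
  have hSk := hE.1 S hS
  have h1 : ((X \ cliqueExt E k S).card : ℝ) ≤ ∑ s ∈ S, ((X \ nbr E (S.erase s)).card : ℝ) := by
    exact_mod_cast CliqueFactor.card_sdiff_cliqueExt_le hk hS hSk X
  have h2 : ∑ s ∈ S, ((X \ nbr E (S.erase s)).card : ℝ) ≤ ∑ s ∈ S, codef k γ * n :=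
    Finset.sum_le_sum fun s hs => hE.card_sdiff_nbr_le
      (by rw [Finset.card_erase_add_one hs, hSk]) X
  rw [Finset.sum_const, hSk, nsmul_eq_mul] at h2
  linarith

lemma card_sdiff_add_card_inter_real (X Y : Finset (Fin n)) :
    ((X \ Y).card : ℝ) + ((X ∩ Y).card : ℝ) = X.card := by
  exact_mod_cast Finset.card_sdiff_add_card_inter X Y

lemma IsCliqueOn.tiled {A : Finset (Fin n)} (h : IsCliqueOn E k A) : Tiled E k A :=
  ⟨{A}, by simpa using h, by simp, by simp⟩

lemma tiled_empty : Tiled E k ∅ := ⟨∅, by simp, by simp, by simp⟩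

lemma Tiled.union {A B : Finset (Fin n)} (hA : Tiled E k A) (hB : Tiled E k B)
    (hAB : Disjoint A B) : Tiled E k (A ∪ B) := by
  obtain ⟨P, hP1, hP2, rfl⟩ := hA
  obtain ⟨Q, hQ1, hQ2, rfl⟩ := hB
  refine ⟨P ∪ Q, ?_, ?_, Finset.union_biUnion⟩
  · intro R hR
    rcases Finset.mem_union.1 hR with h | h
    · exact hP1 R h
    · exact hQ1 R h
  · rw [Finset.coe_union, Set.pairwiseDisjoint_union]
    refine ⟨hP2, hQ2, fun i hi j hj _ => ?_⟩
    exact Finset.disjoint_of_subset_left (Finset.subset_biUnion_of_mem id hi)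
      (Finset.disjoint_of_subset_right (Finset.subset_biUnion_of_mem id hj) hAB)

lemma Tiled.card_dvd {A : Finset (Fin n)} (hA : Tiled E k A) : k + 1 ∣ A.card := by
  obtain ⟨P, hP1, hP2, rfl⟩ := hA
  rw [Finset.card_biUnion hP2]
  exact Finset.dvd_sum fun Q hQ => by simp [(hP1 Q hQ).1]

lemma Tiled.hasFactorOn {A : Finset (Fin n)} (hA : Tiled E k A) :
    HasFactorOn E (cliqueEdges (k + 1) k) A := by
  obtain ⟨P, hP1, hP2, hP3⟩ := hA
  refine ⟨P, fun Q hQ => ?_, hP2, hP3⟩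
  obtain ⟨hc, hq⟩ := hP1 Q hQ
  refine ⟨(Q.orderEmbOfFin hc).toEmbedding, ?_, fun e he => ?_⟩
  · ext v
    simp only [Finset.mem_map, Finset.mem_univ, true_and]
    rw [← Finset.mem_coe, ← Finset.range_orderEmbOfFin Q hc]
    rfl
  · simp only [cliqueEdges, Finset.mem_powersetCard] at he
    refine hq _ (fun v hv => ?_) (by rw [Finset.card_map, he.2])
    obtain ⟨i, -, rfl⟩ := Finset.mem_map.1 hv
    exact Finset.orderEmbOfFin_mem Q hc i

/-- Averaging: a bounded function with large sum is large at many points. -/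
lemma sum_le_card_filter_mul_add {ι : Type*} (s : Finset ι) (f : ι → ℝ) (B t : ℝ)
    (hB : ∀ i ∈ s, f i ≤ B) (ht : 0 ≤ t) :
    ∑ i ∈ s, f i ≤ ((s.filter fun i => t ≤ f i).card : ℝ) * B + s.card * t := by
  have : ∑ i ∈ s, f i ≤ ∑ i ∈ s, ((if t ≤ f i then B else 0) + t) := by
    refine Finset.sum_le_sum fun i hi => ?_
    split_ifs with h
    · linarith [hB i hi]
    · linarith
  rw [Finset.sum_add_distrib, ← Finset.sum_filter] at this
  simpa using this

end Basic

section Counting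

variable {n : ℕ} {P : Finset (Fin n) → Prop} {m : ℕ} {c : ℝ}

lemma many_iff [DecidablePred P] : Many m c P ↔ c * (n : ℝ) ^ m ≤
    (((Finset.powersetCard m Finset.univ).filter P).card : ℝ) := by
  unfold Many
  refine Eq.to_iff ?_
  congr!

lemma Many.mono {Q : Finset (Fin n) → Prop} (h : Many m c P)
    (hPQ : ∀ S, S.card = m → P S → Q S) : Many m c Q := by
  classical
  refine le_trans h ?_
  refine Nat.cast_le.2 (Finset.card_le_card fun S hS => ?_)
  simp only [Finset.mem_filter, Finset.mem_powersetCard_univ] at hS ⊢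
  exact ⟨hS.1, hPQ S hS.1 hS.2⟩

lemma Many.anti {c' : ℝ} (h : Many m c P) (hc : c' ≤ c) : Many m c' P :=
  le_trans (mul_le_mul_of_nonneg_right hc (by positivity)) h

lemma Many.or {Q : Finset (Fin n) → Prop} (h : Many m c fun S => P S ∨ Q S) :
    Many m (c / 2) P ∨ Many m (c / 2) Q := by
  classical
  simp only [many_iff] at *
  rw [Finset.filter_or] at h
  have h1 : (((Finset.powersetCard m Finset.univ).filter P ∪
      (Finset.powersetCard m Finset.univ).filter Q).card : ℝ) ≤
      ((Finset.powersetCard m Finset.univ).filter P).card +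
      ((Finset.powersetCard m Finset.univ).filter Q).card := by
    exact_mod_cast Finset.card_union_le _ _
  by_contra! h2
  linarith

lemma Many.of_erase (hn : 0 < n) (h : Many (m + 1) c fun S => ∃ s ∈ S, P (S.erase s)) :
    Many m c P := by
  classical
  simp only [many_iff] at *
  have hsub : ((Finset.powersetCard (m + 1) Finset.univ).filter fun S => ∃ s ∈ S, P (S.erase s)) ⊆
      ((Finset.powersetCard m Finset.univ).filter P ×ˢ Finset.univ).image
        fun p : Finset (Fin n) × Fin n => insert p.2 p.1 := by
    intro S hS
    simp only [Finset.mem_filter, Finset.mem_powersetCard_univ, Finset.mem_image,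
      Finset.mem_product, Prod.exists] at hS ⊢
    obtain ⟨hS, s, hs, hP⟩ := hS
    refine ⟨S.erase s, s, ⟨⟨?_, hP⟩, Finset.mem_univ _⟩, Finset.insert_erase hs⟩
    rw [Finset.card_erase_of_mem hs, hS]; rfl
  have h1 := (Finset.card_le_card hsub).trans Finset.card_image_le
  rw [Finset.card_product, Finset.card_fin] at h1
  have h2 : c * (n : ℝ) ^ (m + 1) ≤
      (((Finset.powersetCard m Finset.univ).filter P).card : ℝ) * n :=
    h.trans (by exact_mod_cast h1)
  rw [pow_succ, ← mul_assoc] at h2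
  exact le_of_mul_le_mul_right h2 (by exact_mod_cast hn)

lemma card_powersetCard_univ_le (m : ℕ) :
    ((Finset.powersetCard m (Finset.univ : Finset (Fin n))).card : ℝ) ≤ (n : ℝ) ^ m := by
  rw [Finset.card_powersetCard, Finset.card_fin]
  exact_mod_cast Nat.choose_le_pow n m

lemma Many.avoid (h : Many m c P) (Z : Finset (Fin n)) (hZ : 2 * (Z.card : ℝ) ≤ c * n) :
    Many m (c / 2) fun S => P S ∧ Disjoint S Z := by
  classical
  rcases m with _ | m
  · have hc : 0 ≤ c ∨ c < 0 := le_or_gt 0 c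
    rcases hc with hc | hc
    · exact (h.anti (by linarith)).mono fun S hS hP => ⟨hP, by simp [Finset.card_eq_zero.1 hS]⟩
    · unfold Many
      refine le_trans ?_ (Nat.cast_nonneg _)
      simp; linarith
  · rw [many_iff] at h ⊢
    have hsub : (Finset.powersetCard (m + 1) Finset.univ).filter P ⊆
        ((Finset.powersetCard (m + 1) Finset.univ).filter fun S => P S ∧ Disjoint S Z) ∪
        (Z ×ˢ Finset.powersetCard m Finset.univ).image fun p => insert p.1 p.2 := by
      intro S hS
      simp only [Finset.mem_filter, Finset.mem_powersetCard_univ, Finset.mem_union,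
        Finset.mem_image, Finset.mem_product, Prod.exists] at hS ⊢
      by_cases hd : Disjoint S Z
      · exact Or.inl ⟨hS.1, hS.2, hd⟩
      · right
        obtain ⟨z, hz1, hz2⟩ := Finset.not_disjoint_iff.1 hd
        refine ⟨z, S.erase z, ⟨hz2, ?_⟩, Finset.insert_erase hz1⟩
        rw [Finset.card_erase_of_mem hz1, hS.1]; rfl
    have h1 := (Finset.card_le_card hsub).trans (Finset.card_union_le _ _)
    have h2 := (Finset.card_image_le (s := Z ×ˢ Finset.powersetCard m Finset.univ)
      (f := fun p : Fin n × Finset (Fin n) => insert p.1 p.2))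
    rw [Finset.card_product] at h2
    have h3 := card_powersetCard_univ_le (n := n) m
    have h4 : (((Finset.powersetCard (m + 1) Finset.univ).filter P).card : ℝ) ≤
        (((Finset.powersetCard (m + 1) Finset.univ).filter
          fun S => P S ∧ Disjoint S Z).card : ℝ) + Z.card * (n : ℝ) ^ m := by
      refine le_trans (Nat.cast_le.2 (h1.trans (Nat.add_le_add_left h2 _))) ?_
      push_cast
      gcongr
    have h5 : (Z.card : ℝ) * (n : ℝ) ^ m ≤ c / 2 * (n : ℝ) ^ (m + 1) := by
      have : (0 : ℝ) ≤ (n : ℝ) ^ m := by positivity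
      rw [pow_succ]
      nlinarith
    linarith

/-- Unions of disjoint pairs drawn from two dense families form a dense family. -/
lemma Many.join {l : ℕ} {c' : ℝ} {Q : Finset (Fin n) → Finset (Fin n) → Prop}
    (hP : Many m c P) (hc' : 0 ≤ c') (hn : 2 * (m : ℝ) ≤ c' * n)
    (hQ : ∀ S, S.card = m → P S → Many l c' (Q S)) :
    Many (m + l) (c * c' / 2 ^ (m + l + 1)) fun R =>
      ∃ S T, S.card = m ∧ T.card = l ∧ P S ∧ Q S T ∧ Disjoint S T ∧ R = S ∪ T := by
  classical
  set 𝒜 := (Finset.powersetCard m (Finset.univ : Finset (Fin n))).filter P with h𝒜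
  set 𝓑 : Finset (Fin n) → Finset (Finset (Fin n)) := fun S =>
    (Finset.powersetCard l Finset.univ).filter fun T => Q S T ∧ Disjoint T S with h𝓑
  have hB : ∀ S ∈ 𝒜, c' / 2 * (n : ℝ) ^ l ≤ ((𝓑 S).card : ℝ) := by
    intro S hS
    simp only [h𝒜, Finset.mem_filter, Finset.mem_powersetCard_univ] at hS
    have := (hQ S hS.1 hS.2).avoid S (by rw [hS.1]; exact hn)
    exact many_iff.1 this
  set 𝒥 := (Finset.powersetCard (m + l) (Finset.univ : Finset (Fin n))).filter fun R =>
      ∃ S T, S.card = m ∧ T.card = l ∧ P S ∧ Q S T ∧ Disjoint S T ∧ R = S ∪ T with h𝒥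
  have hsum : c * (n : ℝ) ^ m * (c' / 2 * (n : ℝ) ^ l) ≤ ((𝒜.sigma 𝓑).card : ℝ) := by
    rw [Finset.card_sigma]
    push_cast
    have h1 : ∑ S ∈ 𝒜, c' / 2 * (n : ℝ) ^ l ≤ ∑ S ∈ 𝒜, ((𝓑 S).card : ℝ) := Finset.sum_le_sum hB
    rw [Finset.sum_const, nsmul_eq_mul] at h1
    refine le_trans ?_ h1
    refine mul_le_mul_of_nonneg_right ?_ (by positivity)
    exact many_iff.1 hP
  have hfib : (𝒜.sigma 𝓑).card ≤ 2 ^ (m + l) * 𝒥.card := by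
    refine Finset.card_le_mul_card_image_of_maps_to (f := fun p => p.1 ∪ p.2) ?_ _ ?_
    · rintro ⟨S, T⟩ hp
      simp only [Finset.mem_sigma, h𝒜, h𝓑, h𝒥, Finset.mem_filter,
        Finset.mem_powersetCard_univ] at hp ⊢
      refine ⟨?_, S, T, hp.1.1, hp.2.1, hp.1.2, hp.2.2.1, hp.2.2.2.symm, rfl⟩
      rw [Finset.card_union_of_disjoint hp.2.2.2.symm, hp.1.1, hp.2.1]
    · intro R hR
      have hRc : R.card = m + l := by
        simp only [h𝒥, Finset.mem_filter, Finset.mem_powersetCard_univ] at hR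
        exact hR.1
      rw [← hRc, ← Finset.card_powerset]
      refine Finset.card_le_card_of_injOn (fun p => p.1) ?_ ?_
      · rintro ⟨S, T⟩ hp
        have h := (Finset.mem_filter.1 hp).2
        simp only at h
        simpa using h ▸ Finset.subset_union_left
      · rintro ⟨S, T⟩ hp ⟨S', T'⟩ hp' hSS
        simp only at hSS
        subst hSS
        have h1 := Finset.mem_filter.1 hp
        have h2 := Finset.mem_filter.1 hp'
        simp only [Finset.mem_sigma, h𝓑, Finset.mem_filter] at h1 h2
        have : T = T' := by
          rw [← Finset.union_sdiff_cancel_left h1.1.2.2.2.symm,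
            ← Finset.union_sdiff_cancel_left h2.1.2.2.2.symm, h1.2, h2.2]
        rw [this]
  rw [many_iff]
  have hf : ((𝒜.sigma 𝓑).card : ℝ) ≤ 2 ^ (m + l) * (𝒥.card : ℝ) := by exact_mod_cast hfib
  have : c * c' / 2 ^ (m + l + 1) * (n : ℝ) ^ (m + l) =
      (c * (n : ℝ) ^ m * (c' / 2 * (n : ℝ) ^ l)) / 2 ^ (m + l) := by
    rw [pow_add (n : ℝ), pow_succ (2 : ℝ)]
    field_simp
  rw [this, div_le_iff₀ (by positivity)]
  linarith

lemma many_one {p : Fin n → Prop} (A : Finset (Fin n)) (hA : c * n ≤ A.card)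
    (hp : ∀ v ∈ A, p v) : Many 1 c fun S => ∃ v, S = {v} ∧ p v := by
  classical
  rw [many_iff, pow_one]
  refine le_trans hA (Nat.cast_le.2 ?_)
  refine Finset.card_le_card_of_injOn (fun v => {v}) ?_ ?_
  · intro v hv
    simp only [Finset.coe_filter, Set.mem_ofPred_eq, Finset.mem_powersetCard_univ]
    exact ⟨Finset.card_singleton v, v, rfl, hp v hv⟩
  · intro a _ b _ hab
    simpa using hab

lemma many_true (m : ℕ) :
    ∃ c : ℝ, 0 < c ∧ ∃ N : ℕ, ∀ n : ℕ, N ≤ n → Many (n := n) m c fun _ => True := by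
  refine ⟨(1 / 2) ^ m / m.factorial, by positivity, 2 * m, fun n hn => ?_⟩
  classical
  unfold Many
  rw [Finset.filter_true, Finset.card_powersetCard, Finset.card_fin]
  have h := Nat.pow_le_choose (α := ℝ) m n
  refine le_trans ?_ h
  have h1 : (n : ℝ) / 2 ≤ ((n + 1 - m : ℕ) : ℝ) := by
    rw [div_le_iff₀ (by norm_num)]
    norm_cast
    omega
  rw [div_mul_eq_mul_div, ← mul_pow]
  gcongr
  linarith

end Counting

section Cut

variable {n k : ℕ} {E : Finset (Finset (Fin n))} {γ : ℝ}

/-- If many `y ∈ A` have `T ∪ {y}` extending often into `B`, then many `z ∈ B` have `T ∪ {z}`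
extending often into `A`. -/
lemma card_switch {T : Finset (Fin n)} (hT : T.card + 1 = k) (A B : Finset (Fin n)) {p q : ℝ}
    (hp : 0 ≤ p) (hq : 0 ≤ q)
    (h : p * n ≤ (((A ∩ nbr E T).filter fun y =>
      q * n ≤ ((B ∩ cliqueExt E k (insert y T)).card : ℝ)).card : ℝ)) :
    p * q / 2 * n ≤ (((B ∩ nbr E T).filter fun z =>
      p * q / 2 * n ≤ ((A ∩ cliqueExt E k (insert z T)).card : ℝ)).card : ℝ) := by
  classical
  rcases Nat.eq_zero_or_pos n with hn | hn
  · subst hn; simp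
  have hn' : (0 : ℝ) < n := by exact_mod_cast hn
  set Y := (A ∩ nbr E T).filter fun y =>
      q * n ≤ ((B ∩ cliqueExt E k (insert y T)).card : ℝ) with hY
  have h1 : p * n * (q * n) ≤ ∑ y ∈ Y, ((B ∩ cliqueExt E k (insert y T)).card : ℝ) := by
    have : ∑ y ∈ Y, q * (n : ℝ) ≤ ∑ y ∈ Y, ((B ∩ cliqueExt E k (insert y T)).card : ℝ) :=
      Finset.sum_le_sum fun y hy => (Finset.mem_filter.1 hy).2
    rw [Finset.sum_const, nsmul_eq_mul] at this
    exact (mul_le_mul_of_nonneg_right h (by positivity)).trans this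
  have h2 : ∑ y ∈ Y, (B ∩ cliqueExt E k (insert y T)).card ≤
      ∑ z ∈ B ∩ nbr E T, (A ∩ cliqueExt E k (insert z T)).card := by
    have hdc := Finset.sum_card_bipartiteAbove_eq_sum_card_bipartiteBelow (s := Y)
      (t := B ∩ nbr E T) (fun y z => z ∈ cliqueExt E k (insert y T))
    refine le_trans (Finset.sum_le_sum fun y hy => Finset.card_le_card ?_)
      (hdc.le.trans (Finset.sum_le_sum fun z hz => Finset.card_le_card ?_))
    · intro z hz
      rw [Finset.mem_inter] at hz
      have hy' := (Finset.mem_inter.1 (Finset.mem_filter.1 hy).1).2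
      simp only [Finset.bipartiteAbove, Finset.mem_filter, Finset.mem_inter]
      exact ⟨⟨hz.1, (mem_cliqueExt_insert_comm hT hy' hz.2).1⟩, hz.2⟩
    · intro y hy
      simp only [Finset.bipartiteBelow, Finset.mem_filter] at hy
      have hy' := Finset.mem_inter.1 (Finset.mem_filter.1 hy.1).1
      exact Finset.mem_inter.2 ⟨hy'.1, (mem_cliqueExt_insert_comm hT hy'.2 hy.2).2⟩
  have h3 := sum_le_card_filter_mul_add (B ∩ nbr E T)
    (fun z => ((A ∩ cliqueExt E k (insert z T)).card : ℝ)) n (p * q / 2 * n)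
    (fun z _ => by exact_mod_cast card_finset_fin_le _) (by positivity)
  have h2' : ∑ y ∈ Y, ((B ∩ cliqueExt E k (insert y T)).card : ℝ) ≤
      ∑ z ∈ B ∩ nbr E T, ((A ∩ cliqueExt E k (insert z T)).card : ℝ) := by exact_mod_cast h2
  have h4 : ((B ∩ nbr E T).card : ℝ) ≤ n := by exact_mod_cast card_finset_fin_le _
  have h5 : ((B ∩ nbr E T).card : ℝ) * (p * q / 2 * n) ≤ n * (p * q / 2 * n) :=
    mul_le_mul_of_nonneg_right h4 (by positivity)
  refine le_of_mul_le_mul_right ?_ hn'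
  nlinarith

/-- All extensions of `U` extend often into `Y`. -/
def ExtendsInto (E : Finset (Finset (Fin n))) (k : ℕ) (γ : ℝ) (Y U : Finset (Fin n)) : Prop :=
  ∀ y ∈ nbr E U, γ * n ≤ ((Y ∩ cliqueExt E k (insert y U)).card : ℝ)

/-- If an edge rarely extends into the smaller side `X` of a bipartition, then it contains a
`(k - 1)`-set all of whose extensions extend often into the larger side. -/
lemma Dense.exists_extendsInto (hE : Dense E k γ) (hk : 3 ≤ k) (hγ : 0 ≤ γ)
    {X : Finset (Fin n)} (hX : (n : ℝ) / 2 ≤ (Xᶜ.card : ℝ)) {S : Finset (Fin n)} (hS : S ∈ E)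
    (hSX : ((X ∩ cliqueExt E k S).card : ℝ) ≤ γ * n) :
    ∃ s ∈ S, ExtendsInto E k γ Xᶜ (S.erase s) := by
  classical
  have h3 : (3 : ℝ) ≤ k := by exact_mod_cast hk
  have hSk := hE.1 S hS
  have hn0 : (0 : ℝ) ≤ n := Nat.cast_nonneg n
  have hsum : (X.card : ℝ) + (Xᶜ.card : ℝ) = n := by
    have := Finset.card_add_card_compl X
    rw [Fintype.card_fin] at this
    exact_mod_cast this
  obtain ⟨s, hs, hs'⟩ : ∃ s ∈ S, (X.card : ℝ) - γ * n ≤ k * ((X \ nbr E (S.erase s)).card : ℝ) := by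
    by_contra! h
    have h1 : ((X \ cliqueExt E k S).card : ℝ) ≤ ∑ s ∈ S, ((X \ nbr E (S.erase s)).card : ℝ) := by
      exact_mod_cast CliqueFactor.card_sdiff_cliqueExt_le (by omega) hS hSk X
    have hne : S.Nonempty := Finset.card_pos.1 (by omega)
    have h2 := Finset.sum_lt_sum_of_nonempty hne h
    rw [← Finset.mul_sum, Finset.sum_const, hSk, nsmul_eq_mul] at h2
    have h4 := lt_of_mul_lt_mul_left h2 (by linarith)
    have := card_sdiff_add_card_inter_real X (cliqueExt E k S)
    linarith
  refine ⟨s, hs, fun y hy => ?_⟩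
  set U := S.erase s with hU
  have hUk : U.card + 1 = k := by rw [hU, Finset.card_erase_add_one hs, hSk]
  obtain ⟨hyU, hyE⟩ := mem_nbr.1 hy
  have hUm : ((X \ nbr E U).card : ℝ) + ((Xᶜ \ nbr E U).card : ℝ) ≤ codef k γ * n := by
    refine le_trans ?_ (hE.2 U hUk)
    rw [← Nat.cast_add, ← Finset.card_union_of_disjoint]
    · refine Nat.cast_le.2 (Finset.card_le_card fun v hv => ?_)
      simp only [Finset.mem_union, Finset.mem_sdiff] at hv
      rw [Finset.mem_compl]
      tauto
    · rw [Finset.disjoint_left]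
      intro v hv hv'
      simp only [Finset.mem_sdiff, Finset.mem_compl] at hv hv'
      exact hv'.1 hv.1
  have h1 : ((Xᶜ \ cliqueExt E k (insert y U)).card : ℝ) ≤
      ∑ u ∈ insert y U, ((Xᶜ \ nbr E ((insert y U).erase u)).card : ℝ) := by
    exact_mod_cast CliqueFactor.card_sdiff_cliqueExt_le (by omega) hyE (hE.1 _ hyE) Xᶜ
  rw [Finset.sum_insert hyU, Finset.erase_insert hyU] at h1
  have h2 : ∑ u ∈ U, ((Xᶜ \ nbr E ((insert y U).erase u)).card : ℝ) ≤
      ∑ u ∈ U, codef k γ * n := by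
    refine Finset.sum_le_sum fun u hu => hE.card_sdiff_nbr_le ?_ _
    rw [Finset.card_erase_add_one (Finset.mem_insert_of_mem hu), hE.1 _ hyE]
  rw [Finset.sum_const, nsmul_eq_mul] at h2
  have h4 : (U.card : ℝ) = k - 1 := by
    rw [← hUk]; push_cast; ring
  rw [h4] at h2
  have h5 := card_sdiff_add_card_inter_real Xᶜ (cliqueExt E k (insert y U))
  have h6 : (k : ℝ) * codef k γ = ((k : ℝ) + 1) / (2 * k) - k * γ := mul_codef hk
  have h7 : (k : ℝ) * (k * codef k γ) * n = ((k : ℝ) + 1) / 2 * n - k * k * γ * n := by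
    rw [h6]; field_simp
  have h8 : (Xᶜ.card : ℝ) - ((Xᶜ ∩ cliqueExt E k (insert y U)).card : ℝ) ≤
      k * codef k γ * n - ((X \ nbr E U).card : ℝ) := by linarith
  have h9 := mul_le_mul_of_nonneg_left h8 (by linarith : (0 : ℝ) ≤ k)
  have h10 : ((k : ℝ) - 1) * (n / 2) ≤ (k - 1) * (Xᶜ.card : ℝ) :=
    mul_le_mul_of_nonneg_left hX (by linarith)
  have h11 : (k * 3 : ℝ) * (γ * n) ≤ k * k * (γ * n) :=
    mul_le_mul_of_nonneg_right (by nlinarith) (by positivity)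
  have h12 : 3 * (γ * n) ≤ k * (γ * n) := mul_le_mul_of_nonneg_right h3 (by positivity)
  have h13 : (0 : ℝ) ≤ γ * n := by positivity
  refine le_of_mul_le_mul_left (a := (k : ℝ)) ?_ (by linarith)
  nlinarith

/-- Lower bound for the sizes of the sides of the bipartitions under consideration. -/
noncomputable def sideBound (k : ℕ) (γ : ℝ) : ℝ := codef k γ + 1 / 27

lemma Dense.card_inter_nbr_ge (hE : Dense E k γ) {X : Finset (Fin n)}
    (hX : sideBound k γ * n ≤ X.card) {T : Finset (Fin n)} (hT : T.card + 1 = k) :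
    1 / 27 * (n : ℝ) ≤ ((X ∩ nbr E T).card : ℝ) := by
  have h1 := hE.card_sdiff_nbr_le hT X
  have h2 := card_sdiff_add_card_inter_real X (nbr E T)
  unfold sideBound at hX
  linarith

lemma Dense.card_filter_nbr_ge (hE : Dense E k γ) (hk : 3 ≤ k) (hγ : 0 ≤ γ)
    {X : Finset (Fin n)} (hX : sideBound k γ * n ≤ Xᶜ.card) {T : Finset (Fin n)}
    (hT : T.card + 1 = k) :
    1 / 648 * (n : ℝ) ≤ (((nbr E T).filter fun v =>
      1 / 648 * (n : ℝ) ≤ ((Xᶜ ∩ cliqueExt E k (insert v T)).card : ℝ)).card : ℝ) := by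
  classical
  have hn0 : (0 : ℝ) ≤ n := Nat.cast_nonneg n
  have h1 := hE.card_inter_nbr_ge hX hT
  set F := (Xᶜ ∩ nbr E T).filter fun v =>
      1 / 648 * (n : ℝ) ≤ ((Xᶜ ∩ cliqueExt E k (insert v T)).card : ℝ) with hF
  set G := (Xᶜ ∩ nbr E T).filter fun v =>
      1 / 6 * (n : ℝ) ≤ ((X ∩ cliqueExt E k (insert v T)).card : ℝ) with hG
  have hFG : Xᶜ ∩ nbr E T ⊆ F ∪ G := by
    intro v hv
    have hvE := (mem_nbr.1 (Finset.mem_inter.1 hv).2).2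
    simp only [hF, hG, Finset.mem_union, Finset.mem_filter]
    by_contra! h
    have h2 := h.1 hv
    have h3 := h.2 hv
    have h4 := hE.card_sdiff_cliqueExt_le (by omega) hvE Finset.univ
    have h5 := card_sdiff_add_card_inter_real Finset.univ (cliqueExt E k (insert v T))
    have h6 : ((Finset.univ ∩ cliqueExt E k (insert v T)).card : ℝ) =
        ((X ∩ cliqueExt E k (insert v T)).card : ℝ) +
        ((Xᶜ ∩ cliqueExt E k (insert v T)).card : ℝ) := by
      have := Finset.card_inter_add_card_sdiff (cliqueExt E k (insert v T)) X
      rw [Finset.univ_inter, ← this, Finset.inter_comm X, Finset.inter_comm Xᶜ,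
        Finset.sdiff_eq_inter_compl]
      push_cast; rfl
    rw [Finset.card_fin] at h5
    have h7 := mul_le_mul_of_nonneg_right (mul_codef_le hk hγ) hn0
    nlinarith
  have hcard : ((Xᶜ ∩ nbr E T).card : ℝ) ≤ F.card + G.card := by
    exact_mod_cast (Finset.card_le_card hFG).trans (Finset.card_union_le _ _)
  by_cases hGc : 1 / 54 * (n : ℝ) ≤ G.card
  · have := card_switch (E := E) hT Xᶜ X (p := 1 / 54) (q := 1 / 6) (by norm_num) (by norm_num) hGc
    norm_num at this
    refine le_trans (by norm_num; exact this) (Nat.cast_le.2 (Finset.card_le_card fun v hv => ?_))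
    simp only [Finset.mem_filter, Finset.mem_inter] at hv ⊢
    refine ⟨hv.1.2, ?_⟩
    norm_num
    exact hv.2
  · have : (F.card : ℝ) ≤ (((nbr E T).filter fun v =>
      1 / 648 * (n : ℝ) ≤ ((Xᶜ ∩ cliqueExt E k (insert v T)).card : ℝ)).card : ℝ) :=
      Nat.cast_le.2 (Finset.card_le_card
        (Finset.filter_subset_filter _ Finset.inter_subset_right))
    push Not at hGc
    linarith

/-- `S` is an edge extending often into both `X` and its complement. -/
def ExtendsBoth (E : Finset (Finset (Fin n))) (k : ℕ) (θ : ℝ) (X S : Finset (Fin n)) : Prop :=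
  S ∈ E ∧ θ * n ≤ ((X ∩ cliqueExt E k S).card : ℝ) ∧ θ * n ≤ ((Xᶜ ∩ cliqueExt E k S).card : ℝ)

/-- Attaching to every member of a dense family of `m`-sets linearly many vertices. -/
lemma Many.join_insert {m : ℕ} {c c' : ℝ} {P Q : Finset (Fin n) → Prop} (hP : Many m c P)
    (hc' : 0 ≤ c') (hn : 2 * (m : ℝ) ≤ c' * n)
    (hQ : ∀ S, S.card = m → P S → ∃ A : Finset (Fin n), c' * n ≤ A.card ∧
      ∀ v ∈ A, v ∉ S → Q (insert v S)) :
    Many (m + 1) (c * c' / 2 ^ (m + 2)) Q := by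
  refine (hP.join (l := 1) (Q := fun S T => ∃ v, T = {v} ∧ (v ∉ S → Q (insert v S)))
    hc' hn ?_).mono ?_
  · intro S hS hPS
    obtain ⟨A, hA, hAQ⟩ := hQ S hS hPS
    exact many_one A hA hAQ
  · rintro R - ⟨S, T, -, -, -, ⟨v, rfl, hv⟩, hd, rfl⟩
    rw [Finset.union_comm, ← Finset.insert_eq]
    exact hv (by simpa using hd)

lemma exists_many_extendsBoth (hk : 3 ≤ k) (hγ : 0 < γ) (hγ' : γ ≤ 1 / 12) :
    ∃ c θ : ℝ, 0 < c ∧ 0 < θ ∧ ∃ N : ℕ, ∀ n : ℕ, N ≤ n → ∀ E : Finset (Finset (Fin n)),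
      Dense E k γ → ∀ X : Finset (Fin n), sideBound k γ * n ≤ X.card →
      sideBound k γ * n ≤ Xᶜ.card → (n : ℝ) / 2 ≤ (Xᶜ.card : ℝ) →
      Many k c (ExtendsBoth E k θ X) := by
  obtain ⟨j, rfl⟩ : ∃ j, k = j + 1 := ⟨k - 1, by omega⟩
  obtain ⟨c₀, hc₀, N₀, hN₀⟩ := many_true j
  set θ : ℝ := 1 / 27 * γ / 2 with hθ
  have hθ0 : 0 < θ := by positivity
  set c₁ := c₀ * (1 / 648) / 2 ^ (j + 2) with hc₁
  have hc₁0 : 0 < c₁ := by positivity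
  set c₂ := c₁ / 2 * θ / 2 ^ (j + 2) with hc₂
  have hc₂0 : 0 < c₂ := by positivity
  have hle : c₂ ≤ c₁ / 2 := by
    rw [hc₂]
    refine div_le_of_le_mul₀ (by positivity) (by positivity) ?_
    refine mul_le_mul_of_nonneg_left ?_ (by positivity)
    have : (1 : ℝ) ≤ 2 ^ (j + 2) := one_le_pow₀ (by norm_num)
    linarith
  refine ⟨c₂, θ, hc₂0, hθ0, max (max N₀ 1) ⌈2 * (j : ℝ) / θ⌉₊, ?_⟩
  intro n hn E hE X hX hXc hX2
  have hnN : N₀ ≤ n := by omega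
  have hn1 : 0 < n := by omega
  have hn' : 2 * (j : ℝ) ≤ θ * n := by
    have : (2 * (j : ℝ) / θ) ≤ n :=
      (Nat.le_ceil _).trans (by exact_mod_cast (le_max_right _ _).trans hn)
    rw [div_le_iff₀ hθ0] at this
    linarith
  have hn0 : (0 : ℝ) ≤ n := Nat.cast_nonneg n
  have hθn : θ * n ≤ 1 / 648 * n := mul_le_mul_of_nonneg_right (by linarith) hn0
  have hθγ : θ * n ≤ γ * n := mul_le_mul_of_nonneg_right (by linarith) hn0
  have h1 : Many (j + 1) c₁ fun S => S ∈ E ∧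
      θ * n ≤ ((Xᶜ ∩ cliqueExt E (j + 1) S).card : ℝ) := by
    refine (hN₀ n hnN).join_insert (by norm_num) (by linarith) fun T hT _ =>
      ⟨_, hE.card_filter_nbr_ge hk hγ.le hXc (T := T) (by omega), fun v hv _ => ?_⟩
    rw [Finset.mem_filter] at hv
    exact ⟨(mem_nbr.1 hv.1).2, hθn.trans hv.2⟩
  have h2 : Many (j + 1) c₁ fun S => ExtendsBoth E (j + 1) θ X S ∨
      ∃ s ∈ S, ExtendsInto E (j + 1) γ Xᶜ (S.erase s) := by
    refine h1.mono fun S hS hP => ?_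
    by_cases h : θ * n ≤ ((X ∩ cliqueExt E (j + 1) S).card : ℝ)
    · exact Or.inl ⟨hP.1, h, hP.2⟩
    · exact Or.inr (hE.exists_extendsInto hk hγ.le hX2 hP.1 (by linarith))
  rcases h2.or with h | h
  · exact h.anti hle
  · refine (h.of_erase hn1).join_insert hθ0.le hn' fun U hU hP =>
      ⟨_, card_switch (E := E) (k := j + 1) (T := U) (by omega) X Xᶜ (p := 1 / 27) (q := γ)
        (by norm_num) hγ.le ?_, fun v hv _ => ?_⟩
    · rw [Finset.filter_true_of_mem]
      · exact hE.card_inter_nbr_ge hX (by omega)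
      · exact fun y hy => hP y (Finset.mem_inter.1 hy).2
    · simp only [Finset.mem_filter, Finset.mem_inter] at hv
      exact ⟨(mem_nbr.1 hv.1.2).2, hv.2, hθγ.trans (hP v hv.1.2)⟩

/-- Many edges extend to cliques by both `a` and `b`. -/
def LinkClose (E : Finset (Finset (Fin n))) (k : ℕ) (ρ : ℝ) (a b : Fin n) : Prop :=
  Many k ρ fun S => a ∈ cliqueExt E k S ∧ b ∈ cliqueExt E k S

lemma LinkClose.symm {ρ : ℝ} {a b : Fin n} (h : LinkClose E k ρ a b) : LinkClose E k ρ b a :=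
  Many.mono h fun _ _ h => h.symm

lemma LinkClose.anti {ρ ρ' : ℝ} {a b : Fin n} (h : LinkClose E k ρ a b) (hρ : ρ' ≤ ρ) :
    LinkClose E k ρ' a b :=
  Many.anti h hρ

open Classical in
lemma card_linkClose_ge (hn : 0 < n) {c θ : ℝ} (hc : 0 ≤ c) (hθ : 0 ≤ θ) {X : Finset (Fin n)}
    (h : Many k c (ExtendsBoth E k θ X)) :
    c * θ ^ 2 / 2 * (n : ℝ) ^ 2 ≤
      (((X ×ˢ Xᶜ).filter fun p => LinkClose E k (c * θ ^ 2 / 2) p.1 p.2).card : ℝ) := by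
  set ρ := c * θ ^ 2 / 2 with hρ
  have hn' : (0 : ℝ) < n := by exact_mod_cast hn
  set 𝒮 := (Finset.powersetCard k Finset.univ).filter (ExtendsBoth E k θ X) with h𝒮
  have hdc := Finset.sum_card_bipartiteAbove_eq_sum_card_bipartiteBelow (s := 𝒮)
      (t := X ×ˢ Xᶜ) (fun S p => p.1 ∈ cliqueExt E k S ∧ p.2 ∈ cliqueExt E k S)
  have h1 : c * (n : ℝ) ^ k * (θ * n * (θ * n)) ≤
      ∑ S ∈ 𝒮, (((X ×ˢ Xᶜ).bipartiteAbove
        (fun S p => p.1 ∈ cliqueExt E k S ∧ p.2 ∈ cliqueExt E k S) S).card : ℝ) := by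
    have : ∑ S ∈ 𝒮, θ * n * (θ * n) ≤ ∑ S ∈ 𝒮, (((X ×ˢ Xᶜ).bipartiteAbove
        (fun S p => p.1 ∈ cliqueExt E k S ∧ p.2 ∈ cliqueExt E k S) S).card : ℝ) := by
      refine Finset.sum_le_sum fun S hS => ?_
      obtain ⟨-, h2, h3⟩ := (Finset.mem_filter.1 hS).2
      refine (mul_le_mul h2 h3 (by positivity) (by positivity)).trans ?_
      rw [← Nat.cast_mul, ← Finset.card_product]
      refine Nat.cast_le.2 (Finset.card_le_card fun p hp => ?_)
      simp only [Finset.mem_product, Finset.mem_inter, Finset.bipartiteAbove,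
        Finset.mem_filter] at hp ⊢
      tauto
    rw [Finset.sum_const, nsmul_eq_mul] at this
    exact (mul_le_mul_of_nonneg_right (many_iff.1 h) (by positivity)).trans this
  have hdc' : ∑ S ∈ 𝒮, (((X ×ˢ Xᶜ).bipartiteAbove
        (fun S p => p.1 ∈ cliqueExt E k S ∧ p.2 ∈ cliqueExt E k S) S).card : ℝ) =
      ∑ p ∈ X ×ˢ Xᶜ, ((𝒮.bipartiteBelow
        (fun S p => p.1 ∈ cliqueExt E k S ∧ p.2 ∈ cliqueExt E k S) p).card : ℝ) := by
    exact_mod_cast hdc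
  have h𝒮c : (𝒮.card : ℝ) ≤ (n : ℝ) ^ k :=
    le_trans (Nat.cast_le.2 (Finset.card_le_card (Finset.filter_subset _ _)))
      (card_powersetCard_univ_le k)
  have h4 := sum_le_card_filter_mul_add (X ×ˢ Xᶜ)
    (fun p => ((𝒮.bipartiteBelow
        (fun S p => p.1 ∈ cliqueExt E k S ∧ p.2 ∈ cliqueExt E k S) p).card : ℝ))
    ((n : ℝ) ^ k) (ρ * (n : ℝ) ^ k) (fun p _ => le_trans
      (Nat.cast_le.2 (Finset.card_le_card (Finset.filter_subset _ _))) h𝒮c) (by positivity)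
  have h5 : ((X ×ˢ Xᶜ).card : ℝ) ≤ (n : ℝ) ^ 2 := by
    rw [Finset.card_product, Nat.cast_mul, sq]
    exact mul_le_mul (by exact_mod_cast card_finset_fin_le _)
      (by exact_mod_cast card_finset_fin_le _) (by positivity) (by positivity)
  have h6 := mul_le_mul_of_nonneg_right h5 (by positivity : 0 ≤ ρ * (n : ℝ) ^ k)
  have h7 : (((X ×ˢ Xᶜ).filter fun p => ρ * (n : ℝ) ^ k ≤ ((𝒮.bipartiteBelow
        (fun S p => p.1 ∈ cliqueExt E k S ∧ p.2 ∈ cliqueExt E k S) p).card : ℝ)).card : ℝ) ≤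
      (((X ×ˢ Xᶜ).filter fun p => LinkClose E k ρ p.1 p.2).card : ℝ) := by
    refine Nat.cast_le.2 (Finset.card_le_card fun p hp => ?_)
    rw [Finset.mem_filter] at hp ⊢
    refine ⟨hp.1, many_iff.2 (hp.2.trans (Nat.cast_le.2 (Finset.card_le_card fun S hS => ?_)))⟩
    simp only [Finset.bipartiteBelow, Finset.mem_filter, h𝒮] at hS ⊢
    exact ⟨hS.1.1, hS.2⟩
  have h8 := mul_le_mul_of_nonneg_right h7 (by positivity : (0 : ℝ) ≤ (n : ℝ) ^ k)
  refine le_of_mul_le_mul_right ?_ (by positivity : (0 : ℝ) < (n : ℝ) ^ k)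
  have h9 : c * (n : ℝ) ^ k * (θ * n * (θ * n)) = 2 * (ρ * (n : ℝ) ^ 2 * (n : ℝ) ^ k) := by
    rw [hρ]; ring
  linarith

/-- Across every balanced enough bipartition, the link-closeness relation is dense. -/
lemma exists_cut_linkClose (hk : 3 ≤ k) (hγ : 0 < γ) (hγ' : γ ≤ 1 / 12) :
    ∃ ρ : ℝ, 0 < ρ ∧ ∃ N : ℕ, ∀ n : ℕ, N ≤ n → ∀ E : Finset (Finset (Fin n)),
      Dense E k γ → ∀ X : Finset (Fin n), sideBound k γ * n ≤ X.card →
      sideBound k γ * n ≤ Xᶜ.card → ∃ B ⊆ Xᶜ, ρ * n ≤ B.card ∧ ∀ b ∈ B,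
        ∃ A ⊆ X, ρ * n ≤ A.card ∧ ∀ a ∈ A, LinkClose E k ρ b a := by
  classical
  obtain ⟨c, θ, hc, hθ, N, hN⟩ := exists_many_extendsBoth hk hγ hγ'
  set ρ := c * θ ^ 2 / 2 with hρ
  have hρ0 : 0 < ρ := by positivity
  refine ⟨ρ / 2, by positivity, max N 1, fun n hn E hE X hX hXc => ?_⟩
  have hnN : N ≤ n := by omega
  have hn1 : 0 < n := by omega
  have hn' : (0 : ℝ) < n := by exact_mod_cast hn1
  have key : ρ * (n : ℝ) ^ 2 ≤
      (((Xᶜ ×ˢ X).filter fun p => LinkClose E k ρ p.1 p.2).card : ℝ) := by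
    have hsum : (X.card : ℝ) + (Xᶜ.card : ℝ) = n := by
      have := Finset.card_add_card_compl X
      rw [Fintype.card_fin] at this
      exact_mod_cast this
    rcases le_total ((n : ℝ) / 2) (Xᶜ.card : ℝ) with h | h
    · refine (card_linkClose_ge hn1 hc.le hθ.le (hN n hnN E hE X hX hXc h)).trans
        (Nat.cast_le.2 (Finset.card_le_card_of_injOn Prod.swap ?_ Prod.swap_injective.injOn))
      rintro ⟨a, b⟩ hp
      simp only [Finset.coe_filter, Finset.mem_product, Set.mem_ofPred_eq, Prod.swap] at hp ⊢
      exact ⟨⟨hp.1.2, hp.1.1⟩, hp.2.symm⟩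
    · have := card_linkClose_ge hn1 hc.le hθ.le (hN n hnN E hE Xᶜ hXc
        (by rwa [compl_compl]) (by rw [compl_compl]; linarith))
      rwa [compl_compl] at this
  have hsum : (((Xᶜ ×ˢ X).filter fun p => LinkClose E k ρ p.1 p.2).card : ℝ) =
      ∑ b ∈ Xᶜ, ((X.filter fun a => LinkClose E k ρ b a).card : ℝ) := by
    rw [Finset.card_filter, Finset.sum_product]
    push_cast
    refine Finset.sum_congr rfl fun b _ => ?_
    rw [Finset.card_filter]
    push_cast
    rfl
  have h1 := sum_le_card_filter_mul_add Xᶜ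
    (fun b => ((X.filter fun a => LinkClose E k ρ b a).card : ℝ)) n (ρ / 2 * n)
    (fun b _ => by exact_mod_cast card_finset_fin_le _) (by positivity)
  have h2 : (Xᶜ.card : ℝ) ≤ n := by exact_mod_cast card_finset_fin_le _
  have h3 := mul_le_mul_of_nonneg_right h2 (by positivity : 0 ≤ ρ / 2 * n)
  refine ⟨_, Finset.filter_subset (fun b => ρ / 2 * n ≤
    ((X.filter fun a => LinkClose E k ρ b a).card : ℝ)) _, ?_, fun b hb =>
    ⟨_, Finset.filter_subset _ _, (Finset.mem_filter.1 hb).2, fun a ha =>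
      (Finset.mem_filter.1 ha).2.anti (by linarith)⟩⟩
  refine le_of_mul_le_mul_right ?_ hn'
  nlinarith

end Cut

section Closeness

variable {n k : ℕ} {E : Finset (Finset (Fin n))} {γ : ℝ}

lemma exists_forall_le_mul (a : ℝ) {c : ℝ} (hc : 0 < c) : ∃ N : ℕ, ∀ n : ℕ, N ≤ n → a ≤ c * n := by
  refine ⟨⌈a / c⌉₊, fun n hn => ?_⟩
  have : a / c ≤ n := (Nat.le_ceil _).trans (by exact_mod_cast hn)
  rw [div_le_iff₀ hc] at this
  linarith

lemma sideBound_add_le (hk : 3 ≤ k) (hγ : 0 ≤ γ) :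
    sideBound k γ + 2 / 27 ≤ 1 - k * codef k γ := by
  have h3 : (3 : ℝ) ≤ k := by exact_mod_cast hk
  have h : (k : ℝ) + 1 ≤ 16 / 9 * (k * (k / (k + 1))) := by
    rw [mul_div_assoc', mul_div_assoc', le_div_iff₀ (by linarith)]
    nlinarith
  have : ((k : ℝ) + 1) / (2 * (k : ℝ) ^ 2) * (k + 1) ≤ 8 / 9 := by
    rw [div_mul_eq_mul_div, div_le_iff₀ (by positivity)]
    nlinarith
  have h0 : 0 ≤ γ * (k + 1) := by positivity
  unfold sideBound codef
  nlinarith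

lemma Dense.card_cliqueExt_ge (hE : Dense E k γ) (hk : 3 ≤ k) (hγ : 0 ≤ γ)
    {S : Finset (Fin n)} (hS : S ∈ E) :
    (sideBound k γ + 2 / 27) * n ≤ ((cliqueExt E k S).card : ℝ) := by
  have h1 := hE.card_sdiff_cliqueExt_le (by omega) hS Finset.univ
  have h2 := card_sdiff_add_card_inter_real Finset.univ (cliqueExt E k S)
  rw [Finset.univ_inter, Finset.card_fin] at h2
  have h3 := mul_le_mul_of_nonneg_right (sideBound_add_le hk hγ) (Nat.cast_nonneg (α := ℝ) n)
  linarith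

lemma Dense.card_cliqueExt_ge_third (hE : Dense E k γ) (hk : 3 ≤ k) (hγ : 0 ≤ γ)
    {S : Finset (Fin n)} (hS : S ∈ E) :
    1 / 3 * (n : ℝ) ≤ ((cliqueExt E k S).card : ℝ) := by
  have h1 := hE.card_sdiff_cliqueExt_le (by omega) hS Finset.univ
  have h2 := card_sdiff_add_card_inter_real Finset.univ (cliqueExt E k S)
  rw [Finset.univ_inter, Finset.card_fin] at h2
  have h3 := mul_le_mul_of_nonneg_right (mul_codef_le hk hγ) (Nat.cast_nonneg (α := ℝ) n)
  linarith

lemma Dense.card_nbr_ge (hE : Dense E k γ) (hk : 3 ≤ k) (hγ : 0 ≤ γ)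
    {T : Finset (Fin n)} (hT : T.card + 1 = k) : 1 / 3 * (n : ℝ) ≤ ((nbr E T).card : ℝ) := by
  have h1 := hE.card_sdiff_nbr_le hT Finset.univ
  have h2 := card_sdiff_add_card_inter_real Finset.univ (nbr E T)
  rw [Finset.univ_inter, Finset.card_fin] at h2
  have h3 := mul_le_mul_of_nonneg_right (codef_le hk hγ) (Nat.cast_nonneg (α := ℝ) n)
  have : (0 : ℝ) ≤ n := Nat.cast_nonneg _
  linarith

lemma exists_many_link (hk : 3 ≤ k) (hγ : 0 ≤ γ) :
    ∃ c : ℝ, 0 < c ∧ ∃ N : ℕ, ∀ n : ℕ, N ≤ n → ∀ E : Finset (Finset (Fin n)), Dense E k γ →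
      ∀ x : Fin n, Many k c fun S => x ∈ cliqueExt E k S := by
  obtain ⟨j, rfl⟩ : ∃ j, k = j + 2 := ⟨k - 2, by omega⟩
  obtain ⟨c, hc, N, hN⟩ := many_true j
  obtain ⟨N₁, hN₁⟩ := exists_forall_le_mul 2 hc
  obtain ⟨N₂, hN₂⟩ := exists_forall_le_mul (2 * ((j + 1 : ℕ) : ℝ)) (by norm_num : (0 : ℝ) < 1 / 3)
  refine ⟨c / 2 * (1 / 3) / 2 ^ (j + 2) * (1 / 3) / 2 ^ (j + 1 + 2), by positivity,
    max N (max N₁ N₂), fun n hn E hE x => ?_⟩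
  have h1 := hN₂ n (by omega)
  have h2 := (hN n (by omega)).avoid {x} (by simpa using hN₁ n (by omega))
  have h3 : Many (j + 1) (c / 2 * (1 / 3) / 2 ^ (j + 2)) fun S => x ∉ S ∧ insert x S ∈ E := by
    refine h2.join_insert (by norm_num) (by push_cast at h1; linarith) fun T hT hTx => ?_
    have hxT : x ∉ T := by simpa using hTx.2
    refine ⟨_, hE.card_nbr_ge (T := insert x T) hk hγ
      (by rw [Finset.card_insert_of_notMem hxT]; omega), fun v hv hvT => ?_⟩
    rw [mem_nbr] at hv
    simp only [Finset.mem_insert, not_or] at hv ⊢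
    exact ⟨⟨fun h => hv.1.1 h.symm, hxT⟩, by rw [Finset.insert_comm]; exact hv.2⟩
  refine h3.join_insert (by norm_num) h1 fun S hS hSx =>
    ⟨_, hE.card_cliqueExt_ge_third (S := insert x S) hk hγ hSx.2, fun v hv hvS => ?_⟩
  rw [mem_cliqueExt] at hv ⊢
  simp only [Finset.mem_insert, not_or] at hv ⊢
  exact ⟨⟨fun h => hv.1.1 h.symm, hSx.1⟩, by rw [Finset.insert_comm]; exact hv.2⟩

lemma exists_many_clique (hk : 3 ≤ k) (hγ : 0 ≤ γ) :
    ∃ c : ℝ, 0 < c ∧ ∃ N : ℕ, ∀ n : ℕ, N ≤ n → ∀ E : Finset (Finset (Fin n)), Dense E k γ →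
      Many (k + 1) c (IsCliqueOn E k) := by
  obtain ⟨j, rfl⟩ : ∃ j, k = j + 1 := ⟨k - 1, by omega⟩
  obtain ⟨c, hc, N, hN⟩ := many_true j
  obtain ⟨N₂, hN₂⟩ := exists_forall_le_mul (2 * ((j + 1 : ℕ) : ℝ)) (by norm_num : (0 : ℝ) < 1 / 3)
  refine ⟨c * (1 / 3) / 2 ^ (j + 2) * (1 / 3) / 2 ^ (j + 1 + 2), by positivity,
    max N N₂, fun n hn E hE => ?_⟩
  have h1 := hN₂ n (by omega)
  have h3 : Many (j + 1) (c * (1 / 3) / 2 ^ (j + 2)) fun S => S ∈ E :=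
    (hN n (by omega)).join_insert (by norm_num) (by push_cast at h1; linarith) fun T hT _ =>
      ⟨_, hE.card_nbr_ge hk hγ (T := T) (by omega), fun v hv _ => (mem_nbr.1 hv).2⟩
  exact h3.join_insert (by norm_num) h1 fun S hS hSE =>
    ⟨_, hE.card_cliqueExt_ge_third hk hγ hSE, fun v hv _ => (mem_cliqueExt.1 hv).2⟩

lemma exists_card_linkClose_ge (hk : 3 ≤ k) (hγ : 0 ≤ γ) :
    ∃ η : ℝ, 0 < η ∧ ∃ N : ℕ, ∀ n : ℕ, N ≤ n → ∀ E : Finset (Finset (Fin n)), Dense E k γ →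
      ∀ x : Fin n, ∃ A : Finset (Fin n), (sideBound k γ + 1 / 27) * n ≤ A.card ∧
        ∀ a ∈ A, LinkClose E k η x a := by
  classical
  obtain ⟨c, hc, N, hN⟩ := exists_many_link hk hγ
  refine ⟨c / 27, by positivity, max N 1, fun n hn E hE x => ?_⟩
  have hn1 : 0 < n := by omega
  have hn' : (0 : ℝ) < n := by exact_mod_cast hn1
  have hL := many_iff.1 (hN n (by omega) E hE x)
  set L := (Finset.powersetCard k Finset.univ).filter fun S => x ∈ cliqueExt E k S with hLdef
  have hLpos : (0 : ℝ) < L.card := lt_of_lt_of_le (by positivity) hL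
  have hdc := Finset.sum_card_bipartiteAbove_eq_sum_card_bipartiteBelow (s := L)
    (t := Finset.univ) (fun S y => y ∈ cliqueExt E k S)
  have hdc' : ∑ S ∈ L, (((Finset.univ : Finset (Fin n)).bipartiteAbove
        (fun S y => y ∈ cliqueExt E k S) S).card : ℝ) =
      ∑ y, ((L.bipartiteBelow (fun S y => y ∈ cliqueExt E k S) y).card : ℝ) := by
    exact_mod_cast hdc
  have h1 : ∑ S ∈ L, (sideBound k γ + 2 / 27) * (n : ℝ) ≤
      ∑ S ∈ L, (((Finset.univ : Finset (Fin n)).bipartiteAbove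
        (fun S y => y ∈ cliqueExt E k S) S).card : ℝ) := by
    refine Finset.sum_le_sum fun S hS => ?_
    simp only [hLdef, Finset.mem_filter, Finset.mem_powersetCard_univ] at hS
    have hSx := mem_cliqueExt.1 hS.2
    refine (hE.card_cliqueExt_ge hk hγ (hSx.2.2 S (Finset.subset_insert _ _) hS.1)).trans ?_
    refine Nat.cast_le.2 (Finset.card_le_card fun y hy => ?_)
    simpa [Finset.bipartiteAbove] using hy
  rw [Finset.sum_const, nsmul_eq_mul] at h1
  have h2 := sum_le_card_filter_mul_add Finset.univ
    (fun y => ((L.bipartiteBelow (fun S y => y ∈ cliqueExt E k S) y).card : ℝ))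
    L.card (c / 27 * (n : ℝ) ^ k)
    (fun y _ => Nat.cast_le.2 (Finset.card_le_card (Finset.filter_subset _ _))) (by positivity)
  rw [Finset.card_fin] at h2
  refine ⟨Finset.univ.filter fun y => c / 27 * (n : ℝ) ^ k ≤
    ((L.bipartiteBelow (fun S y => y ∈ cliqueExt E k S) y).card : ℝ), ?_, fun y hy => ?_⟩
  · refine le_of_mul_le_mul_right ?_ hLpos
    nlinarith
  · refine many_iff.2 ((Finset.mem_filter.1 hy).2.trans
      (Nat.cast_le.2 (Finset.card_le_card fun S hS => ?_)))
    simp only [Finset.bipartiteBelow, Finset.mem_filter, hLdef] at hS ⊢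
    exact ⟨hS.1.1, hS.1.2, hS.2⟩

/-- `S` can be tiled together with `x`, and also together with `y`. -/
def Connects (E : Finset (Finset (Fin n))) (k : ℕ) (x y : Fin n) (S : Finset (Fin n)) : Prop :=
  x ∉ S ∧ y ∉ S ∧ Tiled E k (insert x S) ∧ Tiled E k (insert y S)

lemma Connects.symm {x y : Fin n} {S : Finset (Fin n)} (h : Connects E k x y S) :
    Connects E k y x S :=
  ⟨h.2.1, h.1, h.2.2.2, h.2.2.1⟩

lemma LinkClose.many_connects {ρ : ℝ} {x y : Fin n} (h : LinkClose E k ρ x y) :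
    Many k ρ (Connects E k x y) :=
  Many.mono h fun S _ ⟨hx, hy⟩ => by
    rw [mem_cliqueExt] at hx hy
    exact ⟨hx.1, hy.1, hx.2.tiled, hy.2.tiled⟩

/-- Closeness is transitive through linearly many intermediate vertices. -/
lemma exists_many_connects_trans (m l : ℕ) {ρ c c' : ℝ} (hρ : 0 < ρ) (hc : 0 < c) (hc' : 0 < c') :
    ∃ d : ℝ, 0 < d ∧ ∃ N : ℕ, ∀ n : ℕ, N ≤ n → ∀ (E : Finset (Finset (Fin n))) (k : ℕ)
      (x y : Fin n) (A : Finset (Fin n)), ρ * n ≤ A.card →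
      (∀ a ∈ A, Many m c (Connects E k x a) ∧ Many l c' (Connects E k a y)) →
      Many (1 + m + l) d (Connects E k x y) := by
  obtain ⟨N₁, hN₁⟩ := exists_forall_le_mul 4 hρ
  obtain ⟨N₂, hN₂⟩ := exists_forall_le_mul 4 hc
  obtain ⟨N₃, hN₃⟩ := exists_forall_le_mul (4 * ((1 + m : ℕ) : ℝ) + 2) hc'
  refine ⟨ρ / 2 * (c / 2) / 2 ^ (1 + m + 1) * (c' / 2) / 2 ^ (1 + m + l + 1), by positivity,
    max N₁ (max N₂ N₃), fun n hn E k x y A hA hAc => ?_⟩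
  have h₁ := hN₁ n (by omega)
  have h₂ := hN₂ n (by omega)
  have h₃ := hN₃ n (by omega)
  have hm0 : (0 : ℝ) ≤ ((1 + m : ℕ) : ℝ) := Nat.cast_nonneg _
  have hxy : ((({x, y} : Finset (Fin n)).card : ℕ) : ℝ) ≤ 2 := by
    exact_mod_cast Finset.card_le_two
  have e1 := (many_one (p := (· ∈ A)) A hA fun v hv => hv).avoid {x, y} (by linarith)
  have e2 := e1.join (l := m) (c' := c / 2)
    (Q := fun T S => (∃ z ∈ A, T = {z} ∧ Connects E k x z S) ∧ Disjoint S {y})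
    (by positivity) (by push_cast; linarith) fun T hT hP => by
      obtain ⟨⟨z, rfl, hz⟩, -⟩ := hP
      exact (Many.mono (hAc z hz).1 fun S _ hS => ⟨z, hz, rfl, hS⟩).avoid {y}
        (by simp; linarith)
  have e3 := e2.join (l := l) (c' := c' / 2)
    (Q := fun R S' => (∃ z S, z ∈ A ∧ z ≠ x ∧ z ≠ y ∧ y ∉ S ∧ R = insert z S ∧
      Connects E k x z S ∧ Connects E k z y S') ∧ Disjoint S' {x})
    (by positivity) (by linarith) fun R hR hP => by
      obtain ⟨T, S, -, -, ⟨⟨z, rfl, hz⟩, hd⟩, ⟨⟨z', hz', hzz, hS⟩, hSy⟩, -, rfl⟩ := hP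
      obtain rfl : z = z' := by simpa using hzz
      simp only [Finset.disjoint_singleton_left, Finset.mem_insert, Finset.mem_singleton,
        not_or] at hd
      refine (Many.mono (hAc z hz).2 fun S' _ hS' => ⟨z, S, hz, hd.1, hd.2, by simpa using hSy,
        (Finset.insert_eq _ _).symm, hS, hS'⟩).avoid {x} (by simp; linarith)
  refine e3.mono ?_
  rintro W - ⟨R, S', -, -, -, ⟨⟨z, S, hz, hzx, hzy, hyS, rfl, hS, hS'⟩, hxS'⟩, hd, rfl⟩
  obtain ⟨a1, a2, a3, a4⟩ := hS
  obtain ⟨b1, b2, b3, b4⟩ := hS'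
  have hxS'' : x ∉ S' := by simpa using hxS'
  rw [Finset.disjoint_insert_left] at hd
  refine ⟨?_, ?_, ?_, ?_⟩
  · simp only [Finset.mem_union, Finset.mem_insert, not_or]
    exact ⟨⟨hzx.symm, a1⟩, hxS''⟩
  · simp only [Finset.mem_union, Finset.mem_insert, not_or]
    exact ⟨⟨hzy.symm, hyS⟩, b2⟩
  · have : insert x (insert z S ∪ S') = insert x S ∪ insert z S' := by
      ext v; simp only [Finset.mem_insert, Finset.mem_union]; tauto
    rw [this]
    refine a3.union b3 ?_
    rw [Finset.disjoint_insert_left, Finset.disjoint_insert_right]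
    simp only [Finset.mem_insert, not_or]
    exact ⟨⟨hzx.symm, hxS''⟩, a2, hd.2⟩
  · have : insert y (insert z S ∪ S') = insert z S ∪ insert y S' := by
      ext v; simp only [Finset.mem_insert, Finset.mem_union]; tauto
    rw [this]
    refine a4.union b4 ?_
    rw [Finset.disjoint_insert_left, Finset.disjoint_insert_right]
    simp only [Finset.mem_insert, not_or]
    exact ⟨⟨hzy, hd.1⟩, hyS, hd.2⟩

lemma exists_many_connects_pad (hk : 3 ≤ k) (hγ : 0 ≤ γ) (m : ℕ) {c : ℝ} (hc : 0 < c) :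
    ∃ d : ℝ, 0 < d ∧ ∃ N : ℕ, ∀ n : ℕ, N ≤ n → ∀ E : Finset (Finset (Fin n)), Dense E k γ →
      ∀ x y : Fin n, Many m c (Connects E k x y) → Many (m + (k + 1)) d (Connects E k x y) := by
  obtain ⟨c', hc', N, hN⟩ := exists_many_clique hk hγ
  obtain ⟨N₁, hN₁⟩ := exists_forall_le_mul (4 * (m : ℝ) + 4) hc'
  refine ⟨c * (c' / 2) / 2 ^ (m + (k + 1) + 1), by positivity, max N N₁,
    fun n hn E hE x y hxy => ?_⟩
  have h₁ := hN₁ n (by omega)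
  have hm0 : (0 : ℝ) ≤ m := Nat.cast_nonneg _
  have hxy2 : ((({x, y} : Finset (Fin n)).card : ℕ) : ℝ) ≤ 2 := by
    exact_mod_cast Finset.card_le_two
  refine (hxy.join (l := k + 1) (c' := c' / 2)
    (Q := fun _ K => IsCliqueOn E k K ∧ Disjoint K {x, y}) (by positivity) (by linarith)
    fun S _ _ => (hN n (by omega) E hE).avoid {x, y} (by linarith)).mono ?_
  rintro R - ⟨S, K, -, -, ⟨h1, h2, h3, h4⟩, ⟨hK, hKd⟩, hd, rfl⟩
  simp only [Finset.disjoint_insert_right, Finset.disjoint_singleton_right] at hKd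
  refine ⟨by simp [h1, hKd.1], by simp [h2, hKd.2], ?_, ?_⟩
  · rw [← Finset.insert_union]
    exact h3.union hK.tiled (Finset.disjoint_insert_left.2 ⟨hKd.1, hd⟩)
  · rw [← Finset.insert_union]
    exact h4.union hK.tiled (Finset.disjoint_insert_left.2 ⟨hKd.2, hd⟩)

lemma exists_card_connects_ge (hk : 3 ≤ k) (hγ : 0 < γ) (hγ' : γ ≤ 1 / 12) :
    ∃ ρ : ℝ, 0 < ρ ∧ ∀ i : ℕ, ∃ m : ℕ, ∃ c : ℝ, 0 < c ∧ ∃ N : ℕ, ∀ n : ℕ, N ≤ n →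
      ∀ E : Finset (Finset (Fin n)), Dense E k γ → ∀ x : Fin n, ∃ R : Finset (Fin n),
        (∀ y ∈ R, Many m c (Connects E k x y)) ∧
        ((sideBound k γ + i * ρ) * n ≤ R.card ∨ (Rᶜ.card : ℝ) ≤ sideBound k γ * n) := by
  classical
  obtain ⟨ρ, hρ, N, hN⟩ := exists_cut_linkClose hk hγ hγ'
  refine ⟨ρ, hρ, fun i => ?_⟩
  induction i with
  | zero =>
    obtain ⟨η, hη, N, hN⟩ := exists_card_linkClose_ge hk hγ.le
    refine ⟨k, η, hη, N, fun n hn E hE x => ?_⟩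
    obtain ⟨A, hA, hA'⟩ := hN n hn E hE x
    refine ⟨A, fun y hy => (hA' y hy).many_connects, Or.inl ?_⟩
    have : (0 : ℝ) ≤ n := Nat.cast_nonneg _
    simp only [Nat.cast_zero, zero_mul, add_zero]
    linarith
  | succ i ih =>
    obtain ⟨m, c, hc, N₁, hN₁⟩ := ih
    obtain ⟨d₁, hd₁, N₂, hN₂⟩ := exists_many_connects_pad hk hγ.le m hc
    obtain ⟨d₂, hd₂, N₃, hN₃⟩ := exists_many_connects_trans m k hρ hc hρ
    refine ⟨m + (k + 1), min d₁ d₂, lt_min hd₁ hd₂, max (max N N₁) (max N₂ N₃),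
      fun n hn E hE x => ?_⟩
    obtain ⟨R, hR, hRc⟩ := hN₁ n (by omega) E hE x
    have hpad : ∀ y ∈ R, Many (m + (k + 1)) (min d₁ d₂) (Connects E k x y) := fun y hy =>
      (hN₂ n (by omega) E hE x y (hR y hy)).anti (min_le_left _ _)
    by_cases hbig : (Rᶜ.card : ℝ) ≤ sideBound k γ * n
    · exact ⟨R, hpad, Or.inr hbig⟩
    push Not at hbig
    have hsize := hRc.resolve_right (not_le.2 hbig)
    have hn0 : (0 : ℝ) ≤ i * ρ * n := by positivity
    obtain ⟨B, hBR, hB, hBA⟩ := hN n (by omega) E hE R (by linarith) hbig.le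
    refine ⟨R ∪ B, fun y hy => ?_, Or.inl ?_⟩
    · rcases Finset.mem_union.1 hy with hy | hy
      · exact hpad y hy
      · obtain ⟨A, hAR, hA, hAc⟩ := hBA y hy
        have := hN₃ n (by omega) E k x y A hA fun a ha =>
          ⟨hR a (hAR ha), (hAc a ha).symm.many_connects⟩
        rw [show 1 + m + k = m + (k + 1) by omega] at this
        exact this.anti (min_le_right _ _)
    · have hd : Disjoint R B :=
        Finset.disjoint_of_subset_right hBR disjoint_compl_right
      rw [Finset.card_union_of_disjoint hd]
      push_cast
      linarith

/-- Any two vertices are close. -/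
lemma exists_forall_many_connects (hk : 3 ≤ k) (hγ : 0 < γ) (hγ' : γ ≤ 1 / 12) :
    ∃ m : ℕ, ∃ c : ℝ, 0 < c ∧ ∃ N : ℕ, ∀ n : ℕ, N ≤ n → ∀ E : Finset (Finset (Fin n)),
      Dense E k γ → ∀ x y : Fin n, Many m c (Connects E k x y) := by
  classical
  obtain ⟨ρ, hρ, h⟩ := exists_card_connects_ge hk hγ hγ'
  obtain ⟨i, hi⟩ := exists_nat_gt ((1 - sideBound k γ) / ρ)
  rw [div_lt_iff₀ hρ] at hi
  obtain ⟨m, c, hc, N₁, hN₁⟩ := h i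
  obtain ⟨η, hη, N₂, hN₂⟩ := exists_card_linkClose_ge hk hγ.le
  obtain ⟨d, hd, N₃, hN₃⟩ := exists_many_connects_trans m k (by norm_num : (0 : ℝ) < 1 / 27) hc hη
  refine ⟨1 + m + k, d, hd, max (max N₁ 1) (max N₂ N₃), fun n hn E hE x y => ?_⟩
  obtain ⟨R, hR, hRc⟩ := hN₁ n (by omega) E hE x
  obtain ⟨A, hA, hAc⟩ := hN₂ n (by omega) E hE y
  have hn' : (0 : ℝ) < n := by exact_mod_cast (by omega : 0 < n)
  have hRc' : (Rᶜ.card : ℝ) ≤ sideBound k γ * n := by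
    refine hRc.resolve_left fun hR => ?_
    have h1 : (R.card : ℝ) ≤ n := by exact_mod_cast card_finset_fin_le _
    nlinarith
  refine hN₃ n (by omega) E k x y (A ∩ R) ?_ fun a ha => ?_
  · have h1 := card_sdiff_add_card_inter_real A R
    have h2 : ((A \ R).card : ℝ) ≤ (Rᶜ.card : ℝ) :=
      Nat.cast_le.2 (Finset.card_le_card fun v hv => by
        rw [Finset.mem_compl]; exact (Finset.mem_sdiff.1 hv).2)
    linarith
  · rw [Finset.mem_inter] at ha
    exact ⟨hR a ha.2, (hAc a ha.1).symm.many_connects⟩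

end Closeness

section Absorbing

variable {k : ℕ} {γ : ℝ}

/-- Any two sets of equal size are exchangeable by means of many connecting sets. -/
lemma exists_forall_many_exchange (hk : 3 ≤ k) (hγ : 0 < γ) (hγ' : γ ≤ 1 / 12) (j : ℕ) :
    ∃ (m : ℕ) (c : ℝ), 0 < c ∧ ∃ N : ℕ, ∀ n : ℕ, N ≤ n →
      ∀ E : Finset (Finset (Fin n)), Dense E k γ → ∀ Q Y : Finset (Fin n),
        Q.card = j → Y.card = j →
        Many m c fun A => Disjoint A (Q ∪ Y) ∧ Tiled E k (A ∪ Q) ∧ Tiled E k (A ∪ Y) := by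
  classical
  induction j with
  | zero =>
    obtain ⟨c, hc, N, hN⟩ := many_true 0
    refine ⟨0, c, hc, N, fun n hn E _ Q Y hQ hY => (hN n hn).mono fun A hA _ => ?_⟩
    rw [Finset.card_eq_zero] at hQ hY hA
    subst hQ hY hA
    simpa using tiled_empty
  | succ j ih =>
    obtain ⟨m, c, hc, N, hN⟩ := ih
    obtain ⟨l, d, hd, N', hN'⟩ := exists_forall_many_connects hk hγ hγ'
    obtain ⟨N₁, hN₁⟩ := exists_forall_le_mul (2 * 2) hc
    obtain ⟨N₂, hN₂⟩ := exists_forall_le_mul (2 * (2 * j)) hd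
    obtain ⟨N₃, hN₃⟩ := exists_forall_le_mul (2 * m) (half_pos hd)
    refine ⟨m + l, c / 2 * (d / 2) / 2 ^ (m + l + 1), by positivity,
      N + N' + N₁ + N₂ + N₃, fun n hn E hE Q Y hQ hY => ?_⟩
    obtain ⟨q, Q', hq, rfl, hQ'⟩ := Finset.card_eq_succ.1 hQ
    obtain ⟨y, Y', hy, rfl, hY'⟩ := Finset.card_eq_succ.1 hY
    have h1 := (hN n (by omega) E hE Q' Y' hQ' hY').avoid {q, y} (by
      refine le_trans ?_ (hN₁ n (by omega))
      have : (({q, y} : Finset (Fin n)).card : ℝ) ≤ 2 := by exact_mod_cast Finset.card_le_two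
      linarith)
    have h2 := (hN' n (by omega) E hE q y).avoid (Q' ∪ Y') (by
      refine le_trans ?_ (hN₂ n (by omega))
      have : ((Q' ∪ Y').card : ℝ) ≤ j + j := by
        exact_mod_cast (Finset.card_union_le _ _).trans (by rw [hQ', hY'])
      linarith)
    refine (h1.join (by positivity) (hN₃ n (by omega)) fun _ _ _ => h2).mono ?_
    rintro R - ⟨A, S, -, -, ⟨⟨hA1, hA2, hA3⟩, hA4⟩, ⟨⟨hS1, hS2, hS3, hS4⟩, hS5⟩, hAS, rfl⟩
    simp only [Finset.disjoint_union_right, Finset.disjoint_insert_right,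
      Finset.disjoint_singleton_right] at hA1 hA4 hS5
    refine ⟨?_, ?_, ?_⟩
    · simp only [Finset.disjoint_union_right, Finset.disjoint_insert_right,
        Finset.disjoint_union_left, Finset.mem_union, not_or]
      tauto
    · have := hA2.union hS3 (by
        simp only [Finset.disjoint_union_left, Finset.disjoint_insert_right,
          Finset.mem_union, not_or]
        exact ⟨⟨hA4.1, hq⟩, hAS, hS5.1.symm⟩)
      convert this using 1
      ext v; simp only [Finset.mem_union, Finset.mem_insert]; tauto
    · have := hA3.union hS4 (by
        simp only [Finset.disjoint_union_left, Finset.disjoint_insert_right,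
          Finset.mem_union, not_or]
        exact ⟨⟨hA4.2, hy⟩, hAS, hS5.2.symm⟩)
      convert this using 1
      ext v; simp only [Finset.mem_union, Finset.mem_insert]; tauto

lemma exists_forall_many_absorb (hk : 3 ≤ k) (hγ : 0 < γ) (hγ' : γ ≤ 1 / 12) :
    ∃ (m : ℕ) (c : ℝ), 0 < c ∧ ∃ N : ℕ, ∀ n : ℕ, N ≤ n →
      ∀ E : Finset (Finset (Fin n)), Dense E k γ → ∀ Q : Finset (Fin n), Q.card = k + 1 →
        Many m c fun A => Disjoint A Q ∧ Tiled E k A ∧ Tiled E k (A ∪ Q) := by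
  classical
  obtain ⟨m, c, hc, N, hN⟩ := exists_forall_many_exchange hk hγ hγ' (k + 1)
  obtain ⟨d, hd, N', hN'⟩ := exists_many_clique hk hγ.le
  obtain ⟨N₁, hN₁⟩ := exists_forall_le_mul (2 * (k + 1 : ℝ)) hd
  obtain ⟨N₂, hN₂⟩ := exists_forall_le_mul (2 * ((k + 1 : ℕ) : ℝ)) hc
  refine ⟨k + 1 + m, d / 2 * c / 2 ^ (k + 1 + m + 1), by positivity,
    N + N' + N₁ + N₂, fun n hn E hE Q hQ => ?_⟩
  have h1 := (hN' n (by omega) E hE).avoid Q (by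
    refine le_trans ?_ (hN₁ n (by omega))
    rw [hQ]; push_cast; rfl)
  refine (h1.join hc.le (hN₂ n (by omega)) fun Y hY _ =>
    hN n (by omega) E hE Q Y hQ hY).mono ?_
  rintro R - ⟨Y, A, -, -, ⟨hY1, hY2⟩, ⟨hA1, hA2, hA3⟩, hYA, rfl⟩
  rw [Finset.disjoint_union_right] at hA1
  refine ⟨Finset.disjoint_union_left.2 ⟨hY2, hA1.1⟩, by rwa [Finset.union_comm], ?_⟩
  rw [Finset.union_assoc]
  exact hY1.tiled.union hA2 (Finset.disjoint_union_right.2 ⟨hYA, hY2⟩)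

open Classical in
/-- Greedily enlarging a tiled set, each round absorbing a positive proportion of the remaining
unabsorbed `(k + 1)`-sets. -/
lemma exists_tiled_card_unabsorbed_le {n m : ℕ} {c : ℝ} (hc : 0 < c) (hc1 : c ≤ 1)
    {E : Finset (Finset (Fin n))}
    (h : ∀ Q : Finset (Fin n), Q.card = k + 1 →
      Many m c fun A => Disjoint A Q ∧ Tiled E k A ∧ Tiled E k (A ∪ Q))
    (Z : Finset (Fin n)) (r : ℕ) (hr : 2 * ((Z.card : ℝ) + r * m) ≤ c * n) :
    ∃ U : Finset (Fin n), Disjoint U Z ∧ U.card ≤ r * m ∧ Tiled E k U ∧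
      (((Finset.powersetCard (k + 1) Finset.univ).filter fun Q =>
        Disjoint Q U ∧ ¬ Tiled E k (U ∪ Q)).card : ℝ) ≤ (1 - c / 2) ^ r * (n : ℝ) ^ (k + 1) := by
  induction r with
  | zero =>
    refine ⟨∅, by simp, by simp, tiled_empty, ?_⟩
    refine le_trans (Nat.cast_le.2 (Finset.card_filter_le _ _)) ?_
    simpa using card_powersetCard_univ_le (n := n) (k + 1)
  | succ r ih =>
    have hm : (0 : ℝ) ≤ m := Nat.cast_nonneg m
    push_cast at hr
    obtain ⟨U, hUZ, hUc, hU, hB⟩ := ih (by nlinarith)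
    set B := (Finset.powersetCard (k + 1) (Finset.univ : Finset (Fin n))).filter fun Q =>
      Disjoint Q U ∧ ¬ Tiled E k (U ∪ Q) with hBdef
    have hUc' : (U.card : ℝ) ≤ r * m := by exact_mod_cast hUc
    set M := Finset.powersetCard m (Finset.univ : Finset (Fin n))
    set R : Finset (Fin n) → Finset (Fin n) → Prop := fun Q A =>
      (Disjoint A Q ∧ Tiled E k A ∧ Tiled E k (A ∪ Q)) ∧ Disjoint A (U ∪ Z) with hR
    have hdeg : ∀ Q ∈ B, c / 2 * (n : ℝ) ^ m ≤ ((M.filter (R Q)).card : ℝ) := by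
      intro Q hQ
      refine many_iff.1 ((h Q (Finset.mem_powersetCard_univ.1 (Finset.mem_filter.1 hQ).1)).avoid
        (U ∪ Z) (le_trans ?_ hr))
      have : ((U ∪ Z).card : ℝ) ≤ U.card + Z.card := by exact_mod_cast Finset.card_union_le _ _
      nlinarith
    have hρ : 0 ≤ 1 - c / 2 := by linarith
    rcases B.eq_empty_or_nonempty with hB0 | ⟨Q₀, hQ₀⟩
    · refine ⟨U, hUZ, hUc.trans (Nat.mul_le_mul_right m (Nat.le_succ r)), hU, ?_⟩
      rw [← hBdef, hB0]
      simp only [Finset.card_empty, Nat.cast_zero]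
      positivity
    have hn : 0 < n := by
      rcases Nat.eq_zero_or_pos n with rfl | hn
      · have := Finset.card_le_univ Q₀
        rw [Finset.mem_powersetCard_univ.1 (Finset.mem_filter.1 hQ₀).1] at this
        simp at this
      · exact hn
    have hBpos : (0 : ℝ) < B.card := by exact_mod_cast Finset.card_pos.2 ⟨Q₀, hQ₀⟩
    have hMne : M.Nonempty := by
      have h1 := hdeg Q₀ hQ₀
      have h2 : (0 : ℝ) < c / 2 * (n : ℝ) ^ m := by positivity
      have h3 : 0 < (M.filter (R Q₀)).card := by exact_mod_cast h2.trans_le h1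
      exact (Finset.card_pos.1 h3).mono (Finset.filter_subset _ _)
    have hsum : ∑ _A ∈ M, c / 2 * (B.card : ℝ) ≤
        ∑ A ∈ M, ((B.filter fun Q => R Q A).card : ℝ) := by
      have hdc : ∑ A ∈ M, (B.filter fun Q => R Q A).card = ∑ Q ∈ B, (M.filter (R Q)).card :=
        (Finset.sum_card_bipartiteAbove_eq_sum_card_bipartiteBelow R (s := B) (t := M)).symm
      have h1 : ∑ _Q ∈ B, c / 2 * (n : ℝ) ^ m ≤ ∑ Q ∈ B, ((M.filter (R Q)).card : ℝ) :=
        Finset.sum_le_sum hdeg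
      have h2 : ((∑ A ∈ M, (B.filter fun Q => R Q A).card : ℕ) : ℝ) =
        ((∑ Q ∈ B, (M.filter (R Q)).card : ℕ) : ℝ) := by rw [hdc]
      push_cast at h2
      rw [h2]
      refine le_trans ?_ h1
      rw [Finset.sum_const, Finset.sum_const, nsmul_eq_mul, nsmul_eq_mul]
      have := mul_le_mul_of_nonneg_right (card_powersetCard_univ_le (n := n) m)
        (by positivity : 0 ≤ c / 2 * (B.card : ℝ))
      linarith
    obtain ⟨A, hA, hAB⟩ := Finset.exists_le_of_sum_le hMne hsum
    have hpos : 0 < (B.filter fun Q => R Q A).card := by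
      have : (0 : ℝ) < c / 2 * B.card := by positivity
      exact_mod_cast this.trans_le hAB
    obtain ⟨Q₁, hQ₁⟩ := Finset.card_pos.1 hpos
    obtain ⟨⟨-, hAT, -⟩, hAUZ⟩ := (Finset.mem_filter.1 hQ₁).2
    rw [Finset.disjoint_union_right] at hAUZ
    refine ⟨U ∪ A, Finset.disjoint_union_left.2 ⟨hUZ, hAUZ.2⟩, ?_,
      hU.union hAT hAUZ.1.symm, ?_⟩
    · refine (Finset.card_union_le _ _).trans ?_
      rw [Finset.mem_powersetCard_univ.1 hA, Nat.succ_mul]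
      omega
    have hsub : ((Finset.powersetCard (k + 1) (Finset.univ : Finset (Fin n))).filter fun Q =>
        Disjoint Q (U ∪ A) ∧ ¬ Tiled E k (U ∪ A ∪ Q)) ⊆ B \ B.filter fun Q => R Q A := by
      intro Q hQ
      rw [Finset.mem_filter, Finset.disjoint_union_right] at hQ
      obtain ⟨hQc, ⟨hQU, hQA⟩, hQT⟩ := hQ
      refine Finset.mem_sdiff.2
        ⟨Finset.mem_filter.2 ⟨hQc, hQU, fun hT => hQT ?_⟩, fun hRQ => hQT ?_⟩
      · rw [Finset.union_right_comm]
        exact hT.union hAT (Finset.disjoint_union_left.2 ⟨hAUZ.1.symm, hQA⟩)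
      · rw [Finset.union_assoc]
        exact hU.union (Finset.mem_filter.1 hRQ).2.1.2.2
          (Finset.disjoint_union_right.2 ⟨hAUZ.1.symm, hQU.symm⟩)
    refine le_trans (Nat.cast_le.2 (Finset.card_le_card hsub)) ?_
    rw [Finset.cast_card_sdiff (Finset.filter_subset _ _), pow_succ]
    nlinarith

lemma exists_forall_exists_absorbing (hk : 3 ≤ k) (hγ : 0 < γ) (hγ' : γ ≤ 1 / 12) :
    ∃ δ : ℝ, 0 < δ ∧ ∀ ε : ℝ, 0 < ε → ∃ N : ℕ, ∀ n : ℕ, N ≤ n →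
      ∀ E : Finset (Finset (Fin n)), Dense E k γ → ∀ Z : Finset (Fin n), (Z.card : ℝ) ≤ δ * n →
        ∃ U : Finset (Fin n), Disjoint U Z ∧ (U.card : ℝ) ≤ ε * n ∧ Tiled E k U ∧
          ∀ Q : Finset (Fin n), Q.card = k + 1 → Disjoint Q U → Tiled E k (U ∪ Q) := by
  classical
  obtain ⟨m, c₀, hc₀, N, hN⟩ := exists_forall_many_absorb hk hγ hγ'
  set c := min c₀ 1 with hcdef
  have hc : 0 < c := lt_min hc₀ one_pos
  have hc1 : c ≤ 1 := min_le_right _ _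
  refine ⟨c / 4, by positivity, fun ε hε => ?_⟩
  obtain ⟨K, hK⟩ := exists_nat_gt (max (4 * m / c) (m / ε))
  rw [max_lt_iff, div_lt_iff₀ hc, div_lt_iff₀ hε] at hK
  have hKpos : 0 < K := by
    rcases Nat.eq_zero_or_pos K with rfl | h
    · have : (0 : ℝ) ≤ m := Nat.cast_nonneg m
      simp at hK; linarith
    · exact h
  have hK' : (0 : ℝ) < K := by exact_mod_cast hKpos
  have hlim := (tendsto_pow_const_mul_const_pow_of_abs_lt_one (k + 1)
    (by rw [abs_lt]; constructor <;> linarith : |1 - c / 2| < 1)).comp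
    (Nat.tendsto_div_const_atTop hKpos.ne')
  have hpos : (0 : ℝ) < 1 / (2 * K) ^ (k + 1) := by positivity
  obtain ⟨N', hN'⟩ := Filter.eventually_atTop.1 (hlim.eventually (gt_mem_nhds hpos))
  refine ⟨N + N' + K, fun n hn E hE Z hZ => ?_⟩
  set r := n / K with hr
  have hrK : (r : ℝ) * K ≤ n := by exact_mod_cast Nat.div_mul_le_self n K
  have hnr : (n : ℝ) ≤ 2 * K * r := by
    have h1 : 1 ≤ r := (Nat.one_le_div_iff hKpos).2 (by omega)
    have h2 : n < K * (r + 1) := Nat.lt_mul_div_succ n hKpos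
    have h3 : n ≤ 2 * K * r := by nlinarith
    exact_mod_cast h3
  have hrm1 : 4 * ((r : ℝ) * m) ≤ c * n := by
    have : (0 : ℝ) ≤ r := Nat.cast_nonneg r
    nlinarith [mul_le_mul_of_nonneg_left hK.1.le this, mul_le_mul_of_nonneg_left hrK hc.le]
  have hrm2 : (r : ℝ) * m ≤ ε * n := by
    have : (0 : ℝ) ≤ r := Nat.cast_nonneg r
    nlinarith [mul_le_mul_of_nonneg_left hK.2.le this, mul_le_mul_of_nonneg_left hrK hε.le]
  obtain ⟨U, hUZ, hUc, hU, hB⟩ := exists_tiled_card_unabsorbed_le hc hc1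
    (fun Q hQ => (hN n (by omega) E hE Q hQ).anti (min_le_left _ _)) Z r (by linarith)
  refine ⟨U, hUZ, le_trans (by exact_mod_cast hUc) hrm2, hU, fun Q hQ hQU => ?_⟩
  by_contra hQT
  have h1 := hN' n (by omega)
  simp only [Function.comp, lt_div_iff₀ (by positivity : (0 : ℝ) < (2 * K) ^ (k + 1))] at h1
  have hρ : 0 ≤ 1 - c / 2 := by linarith
  have h2 : (1 - c / 2) ^ r * (n : ℝ) ^ (k + 1) ≤
      (1 - c / 2) ^ r * (2 * K * r) ^ (k + 1) := by gcongr
  have h3 : (1 - c / 2) ^ r * (2 * K * (r : ℝ)) ^ (k + 1) =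
      (r : ℝ) ^ (k + 1) * (1 - c / 2) ^ r * (2 * K) ^ (k + 1) := by rw [mul_pow]; ring
  have h4 := hB.trans_lt ((h2.trans_eq h3).trans_lt h1)
  have h5 := Finset.card_eq_zero.1 (Nat.lt_one_iff.1 (by exact_mod_cast h4))
  have : Q ∈ (∅ : Finset (Finset (Fin n))) := by
    rw [← h5, Finset.mem_filter]
    exact ⟨Finset.mem_powersetCard_univ.2 hQ, hQU, hQT⟩
  simp at this

/-- A small tiled set that absorbs every set of bounded size divisible by `k + 1`. -/
lemma exists_forall_exists_absorbing_bounded (hk : 3 ≤ k) (hγ : 0 < γ) (hγ' : γ ≤ 1 / 12)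
    (C : ℕ) : ∀ ε : ℝ, 0 < ε → ∃ N : ℕ, ∀ n : ℕ, N ≤ n →
      ∀ E : Finset (Finset (Fin n)), Dense E k γ →
        ∃ U : Finset (Fin n), (U.card : ℝ) ≤ ε * n ∧ Tiled E k U ∧
          ∀ W : Finset (Fin n), k + 1 ∣ W.card → W.card ≤ (k + 1) * C → Disjoint U W →
            Tiled E k (U ∪ W) := by
  classical
  induction C with
  | zero =>
    refine fun ε hε => ⟨0, fun n _ E _ => ⟨∅, by simp; positivity, tiled_empty, ?_⟩⟩
    intro W _ hW _
    rw [Nat.mul_zero, Nat.le_zero, Finset.card_eq_zero] at hW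
    simpa [hW] using tiled_empty
  | succ C ih =>
    intro ε hε
    obtain ⟨δ, hδ, h⟩ := exists_forall_exists_absorbing hk hγ hγ'
    obtain ⟨N, hN⟩ := h (ε / 2) (by positivity)
    obtain ⟨N', hN'⟩ := ih (min (ε / 2) δ) (by positivity)
    refine ⟨N + N', fun n hn E hE => ?_⟩
    obtain ⟨U, hUc, hU, hUW⟩ := hN' n (by omega) E hE
    have hn0 : (0 : ℝ) ≤ n := Nat.cast_nonneg n
    obtain ⟨U', hUU, hUc', hU', hUQ⟩ := hN n (by omega) E hE U
      (hUc.trans (mul_le_mul_of_nonneg_right (min_le_right _ _) hn0))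
    refine ⟨U ∪ U', ?_, hU.union hU' hUU.symm, fun W hdvd hW hd => ?_⟩
    · have h1 : ((U ∪ U').card : ℝ) ≤ U.card + U'.card := by
        exact_mod_cast Finset.card_union_le _ _
      have h2 := mul_le_mul_of_nonneg_right (min_le_left (ε / 2) δ) hn0
      linarith
    rcases W.eq_empty_or_nonempty with rfl | hne
    · simpa using hU.union hU' hUU.symm
    obtain ⟨Q, hQW, hQ⟩ := Finset.exists_subset_card_eq
      (Nat.le_of_dvd (Finset.card_pos.2 hne) hdvd)
    rw [Finset.disjoint_union_left] at hd
    have hsd : (W \ Q).card = W.card - (k + 1) := by rw [Finset.card_sdiff_of_subset hQW, hQ]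
    have h1 := hUW (W \ Q) (by rw [hsd]; exact Nat.dvd_sub hdvd dvd_rfl)
      (by rw [hsd]; rw [Nat.mul_succ] at hW; omega)
      (Finset.disjoint_of_subset_right Finset.sdiff_subset hd.1)
    have h2 := hUQ Q hQ (Finset.disjoint_of_subset_left hQW hd.2.symm)
    have h3 := h1.union h2 (by
      rw [Finset.disjoint_union_left, Finset.disjoint_union_right, Finset.disjoint_union_right]
      exact ⟨⟨hUU.symm, Finset.disjoint_of_subset_right hQW hd.1⟩,
        Finset.disjoint_of_subset_left Finset.sdiff_subset hd.2.symm, Finset.sdiff_disjoint⟩)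
    convert h3 using 1
    ext v
    have := @hQW v
    simp only [Finset.mem_union, Finset.mem_sdiff]
    tauto

end Absorbing

section Packing

variable {n k : ℕ} {E : Finset (Finset (Fin n))}

/-- If a bipartite relation has no matching of size `r`, then it is covered by `r - 1` vertices of
one side together with at most `r - 1` pairs at each other vertex of that side. -/
lemma sum_card_inter_le_of_no_matching {α β : Type*} [DecidableEq α] [DecidableEq β]
    (𝒯 : Finset β) (Q : Finset α) (N : β → Finset α) (r : ℕ)
    (h : ∀ S ⊆ Q, S.card = r + 1 → ∀ f : α → β, Set.InjOn f S → ¬ ∀ v ∈ S, f v ∈ 𝒯 ∧ v ∈ N (f v)) :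
    ∑ T ∈ 𝒯, (N T ∩ Q).card ≤ r * (𝒯.card + Q.card) := by
  classical
  set d : α → Finset β := fun v => 𝒯.filter fun T => v ∈ N T with hd
  have hdc : ∑ T ∈ 𝒯, (N T ∩ Q).card = ∑ v ∈ Q, (d v).card := by
    refine Eq.trans ?_ (Finset.sum_card_bipartiteAbove_eq_sum_card_bipartiteBelow
      (fun v T => v ∈ N T) (s := Q) (t := 𝒯)).symm
    refine Finset.sum_congr rfl fun T _ => ?_
    congr 1
    ext v
    simp [Finset.mem_bipartiteBelow, and_comm]
  have hheavy : (Q.filter fun v => r < (d v).card).card ≤ r := by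
    by_contra! hlt
    obtain ⟨S, hS, hSr⟩ := Finset.exists_subset_card_eq (Nat.succ_le_of_lt hlt)
    obtain ⟨f, hf, hfd⟩ := (Finset.all_card_le_biUnion_card_iff_exists_injective
      (fun v : S => d v)).1 (by
        intro s
        rcases s.eq_empty_or_nonempty with rfl | ⟨v, hv⟩
        · simp
        · have h1 : s.card ≤ r + 1 := by
            have := s.card_le_univ
            rwa [Fintype.card_coe, hSr] at this
          have h2 := (Finset.mem_filter.1 (hS v.2)).2
          have h3 := Finset.card_le_card (Finset.subset_biUnion_of_mem (fun v : S => d v) hv)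
          omega)
    obtain ⟨v₀, hv₀⟩ := Finset.card_pos.1 (by omega : 0 < S.card)
    refine h S (hS.trans (Finset.filter_subset _ _)) hSr
      (fun v => if hv : v ∈ S then f ⟨v, hv⟩ else f ⟨v₀, hv₀⟩) ?_ ?_
    · intro a ha b hb hab
      rw [Finset.mem_coe] at ha hb
      simp only [ha, hb, dif_pos] at hab
      exact congrArg Subtype.val (hf hab)
    · intro v hv
      simp only [hv, dif_pos]
      exact Finset.mem_filter.1 (hfd ⟨v, hv⟩)
  rw [hdc]
  have hle : ∑ v ∈ Q, (d v).card ≤ ∑ v ∈ Q, ((if r < (d v).card then 𝒯.card else 0) + r) := by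
    refine Finset.sum_le_sum fun v _ => ?_
    have := Finset.card_filter_le 𝒯 fun T => v ∈ N T
    split_ifs with hv
    · simp only [hd]; omega
    · omega
  rw [Finset.sum_add_distrib, ← Finset.sum_filter, Finset.sum_const, Finset.sum_const,
    smul_eq_mul, smul_eq_mul] at hle
  nlinarith [Nat.mul_le_mul_right 𝒯.card hheavy]

/-- A family of pairwise disjoint edges and cliques inside `V`. -/
def IsPacking (E : Finset (Finset (Fin n))) (k : ℕ) (V : Finset (Fin n))
    (F : Finset (Finset (Fin n))) : Prop :=
  (∀ A ∈ F, A ⊆ V ∧ (A ∈ E ∨ IsCliqueOn E k A)) ∧ (F : Set (Finset (Fin n))).PairwiseDisjoint id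

/-- The weight of an edge or a clique in a packing. -/
def weight (k : ℕ) (A : Finset (Fin n)) : ℕ := if A.card = k + 1 then 5 else 2

/-- A packing of maximum total weight. -/
def IsMaxPacking (E : Finset (Finset (Fin n))) (k : ℕ) (V : Finset (Fin n))
    (F : Finset (Finset (Fin n))) : Prop :=
  IsPacking E k V F ∧ ∀ F', IsPacking E k V F' → ∑ A ∈ F', weight k A ≤ ∑ A ∈ F, weight k A

lemma exists_isMaxPacking (E : Finset (Finset (Fin n))) (k : ℕ) (V : Finset (Fin n)) :
    ∃ F, IsMaxPacking E k V F := by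
  classical
  obtain ⟨F, hF, hmax⟩ := Finset.exists_max_image
    (Finset.univ.filter fun F => IsPacking E k V F) (fun F => ∑ A ∈ F, weight k A)
    ⟨∅, Finset.mem_filter.2 ⟨Finset.mem_univ _, by simp [IsPacking]⟩⟩
  exact ⟨F, (Finset.mem_filter.1 hF).2, fun F' hF' =>
    hmax F' (Finset.mem_filter.2 ⟨Finset.mem_univ _, hF'⟩)⟩

lemma IsMaxPacking.sum_weight_le (hk : 1 ≤ k) (hE : ∀ e ∈ E, e.card = k)
    {V : Finset (Fin n)} {F : Finset (Finset (Fin n))} (hF : IsMaxPacking E k V F)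
    {D : Finset (Finset (Fin n))} (hD : D ⊆ F) (s : Finset (Fin n))
    (g : Fin n → Finset (Fin n)) (hgV : ∀ i ∈ s, g i ⊆ V)
    (hg : ∀ i ∈ s, g i ∈ E ∨ IsCliqueOn E k (g i))
    (hdisj : (s : Set (Fin n)).PairwiseDisjoint g)
    (hgF : ∀ i ∈ s, ∀ A ∈ F, A ∉ D → Disjoint (g i) A) :
    ∑ i ∈ s, weight k (g i) ≤ ∑ A ∈ D, weight k A := by
  classical
  have hne : ∀ i ∈ s, (g i).Nonempty := by
    intro i hi
    refine Finset.card_pos.1 ?_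
    rcases hg i hi with h | h
    · have := hE _ h; omega
    · have := h.1; omega
  have hinj : Set.InjOn g s := by
    intro i hi j hj hij
    by_contra hne'
    have := hdisj hi hj hne'
    simp only [Function.onFun, ← hij, disjoint_self, Finset.bot_eq_empty] at this
    exact (hne i hi).ne_empty this
  have hpack : IsPacking E k V (F \ D ∪ s.image g) := by
    refine ⟨fun A hA => ?_, ?_⟩
    · rcases Finset.mem_union.1 hA with h | h
      · exact hF.1.1 A (Finset.sdiff_subset h)
      · obtain ⟨i, hi, rfl⟩ := Finset.mem_image.1 h
        exact ⟨hgV i hi, hg i hi⟩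
    · rw [Finset.coe_union, Set.pairwiseDisjoint_union]
      refine ⟨hF.1.2.subset (by simp), ?_, ?_⟩
      · rw [Finset.coe_image]
        rintro _ ⟨i, hi, rfl⟩ _ ⟨j, hj, rfl⟩ hij
        exact hdisj hi hj fun h => hij (congrArg g h)
      · intro A hA B hB _
        obtain ⟨i, hi, rfl⟩ := Finset.mem_image.1 hB
        obtain ⟨hA1, hA2⟩ := Finset.mem_sdiff.1 hA
        exact (hgF i hi A hA1 hA2).symm
  have hd : Disjoint (F \ D) (s.image g) := by
    rw [Finset.disjoint_left]
    intro A hA hB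
    obtain ⟨i, hi, rfl⟩ := Finset.mem_image.1 hB
    obtain ⟨hA1, hA2⟩ := Finset.mem_sdiff.1 hA
    have := hgF i hi _ hA1 hA2
    rw [disjoint_self] at this
    exact (hne i hi).ne_empty this
  have h1 := hF.2 _ hpack
  rw [Finset.sum_union hd, Finset.sum_image hinj, ← Finset.sum_sdiff hD] at h1
  omega

lemma weight_of_card_eq_succ {A : Finset (Fin n)} (h : A.card = k + 1) : weight k A = 5 := by
  simp [weight, h]

lemma weight_of_card_ne {A : Finset (Fin n)} (h : A.card ≠ k + 1) : weight k A = 2 := by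
  simp [weight, h]

lemma IsMaxPacking.exists_mem_of_mem_cliqueExt (hk : 1 ≤ k) (hE : ∀ e ∈ E, e.card = k)
    {V : Finset (Fin n)} {F : Finset (Finset (Fin n))} (hF : IsMaxPacking E k V F)
    {e : Finset (Fin n)} (he : e ∈ F) (hek : e.card ≠ k + 1) {v : Fin n} (hvV : v ∈ V)
    (hv : v ∈ cliqueExt E k e) : ∃ Q ∈ F, Q.card = k + 1 ∧ v ∈ Q := by
  classical
  by_contra! hcon
  obtain ⟨-, hvc⟩ := mem_cliqueExt.1 hv
  have h := hF.sum_weight_le hk hE (D := insert e (F.filter fun A => v ∈ A))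
    (Finset.insert_subset he (Finset.filter_subset _ _)) {v} (fun _ => insert v e)
    (fun _ _ => Finset.insert_subset hvV (hF.1.1 e he).1) (fun _ _ => Or.inr hvc)
    (by simp) (by
      intro _ _ A hA hAD
      simp only [Finset.mem_insert, Finset.mem_filter, not_or, not_and] at hAD
      rw [Finset.disjoint_insert_left]
      exact ⟨hAD.2 hA, hF.1.2 he hA (Ne.symm hAD.1)⟩)
  rw [Finset.sum_singleton, weight_of_card_eq_succ hvc.1] at h
  have h1 : (F.filter fun A => v ∈ A).card ≤ 1 := by
    rw [Finset.card_le_one]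
    intro A hA B hB
    rw [Finset.mem_filter] at hA hB
    by_contra hAB
    exact Finset.disjoint_left.1 (hF.1.2 hA.1 hB.1 hAB) hA.2 hB.2
  have h2 : ∑ A ∈ insert e (F.filter fun A => v ∈ A), weight k A ≤
      (insert e (F.filter fun A => v ∈ A)).card • 2 := Finset.sum_le_card_nsmul _ _ _ (by
    intro A hA
    refine (weight_of_card_ne ?_).le
    rcases Finset.mem_insert.1 hA with rfl | hA
    · exact hek
    · rw [Finset.mem_filter] at hA
      exact fun hc => hcon A hA.1 hc hA.2)
  have h3 := Finset.card_insert_le e (F.filter fun A => v ∈ A)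
  rw [smul_eq_mul] at h2
  omega

lemma IsMaxPacking.not_matching_cliqueExt (hk : 1 ≤ k) (hE : ∀ e ∈ E, e.card = k)
    {V : Finset (Fin n)} {F : Finset (Finset (Fin n))} (hF : IsMaxPacking E k V F)
    {Q : Finset (Fin n)} (hQ : Q ∈ F) (hQk : Q.card = k + 1) {S : Finset (Fin n)} (hSQ : S ⊆ Q)
    (hS : S.card = 2) {f : Fin n → Finset (Fin n)} (hf : Set.InjOn f S) :
    ¬ ∀ v ∈ S, f v ∈ F.filter (fun A => A.card ≠ k + 1) ∧ v ∈ cliqueExt E k (f v) := by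
  classical
  intro hcon
  have hfF : ∀ v ∈ S, f v ∈ F := fun v hv => (Finset.mem_filter.1 (hcon v hv).1).1
  have hfk : ∀ v ∈ S, (f v).card ≠ k + 1 := fun v hv => (Finset.mem_filter.1 (hcon v hv).1).2
  have hc : ∀ v ∈ S, IsCliqueOn E k (insert v (f v)) :=
    fun v hv => (mem_cliqueExt.1 (hcon v hv).2).2
  have hnot : ∀ v ∈ S, ∀ w ∈ S, v ∉ f w := fun v hv w hw hvw =>
    Finset.disjoint_left.1 (hF.1.2 hQ (hfF w hw) fun h => hfk w hw (h ▸ hQk)) (hSQ hv) hvw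
  have h := hF.sum_weight_le hk hE (D := insert Q (S.image f))
    (Finset.insert_subset hQ (Finset.image_subset_iff.2 hfF)) S (fun v => insert v (f v))
    (fun v hv => Finset.insert_subset ((hF.1.1 Q hQ).1 (hSQ hv)) (hF.1.1 _ (hfF v hv)).1)
    (fun v hv => Or.inr (hc v hv)) (by
      intro v hv w hw hvw
      rw [Finset.mem_coe] at hv hw
      simp only [Function.onFun, Finset.disjoint_insert_left, Finset.disjoint_insert_right,
        Finset.mem_insert, not_or]
      exact ⟨⟨Ne.symm hvw, hnot w hw v hv⟩, hnot v hv w hw,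
        hF.1.2 (hfF v hv) (hfF w hw) fun h => hvw (hf hv hw h)⟩) (by
      intro v hv A hA hAD
      simp only [Finset.mem_insert, Finset.mem_image, not_or, not_exists, not_and] at hAD
      rw [Finset.disjoint_insert_left]
      exact ⟨Finset.disjoint_left.1 (hF.1.2 hQ hA (Ne.symm hAD.1)) (hSQ hv),
        hF.1.2 (hfF v hv) hA (hAD.2 v hv)⟩)
  rw [Finset.sum_congr rfl fun v hv => weight_of_card_eq_succ (hc v hv).1, Finset.sum_const, hS]
    at h
  have h1 : ∑ A ∈ insert Q (S.image f), weight k A ≤ 5 + 2 * 2 := by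
    rw [Finset.sum_insert (by
      simp only [Finset.mem_image, not_exists, not_and]
      exact fun v hv h => hfk v hv (h ▸ hQk)), weight_of_card_eq_succ hQk, Finset.sum_image hf,
      Finset.sum_congr rfl fun v hv => weight_of_card_ne (hfk v hv), Finset.sum_const, hS,
      smul_eq_mul]
  rw [smul_eq_mul] at h
  omega

lemma IsMaxPacking.exists_mem_of_mem_nbr (hk : 1 ≤ k) (hE : ∀ e ∈ E, e.card = k)
    {V : Finset (Fin n)} {F : Finset (Finset (Fin n))} (hF : IsMaxPacking E k V F)
    {T : Finset (Fin n)} (hT : T ⊆ V \ F.biUnion id) {v : Fin n} (hvV : v ∈ V)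
    (hv : v ∈ nbr E T) : v ∈ F.biUnion id := by
  classical
  by_contra hcon
  have hTV : T ⊆ V := hT.trans Finset.sdiff_subset
  have h := hF.sum_weight_le hk hE (D := ∅) (Finset.empty_subset _) {v} (fun _ => insert v T)
    (fun _ _ => Finset.insert_subset hvV hTV) (fun _ _ => Or.inl (mem_nbr.1 hv).2) (by simp) (by
      intro _ _ A hA _
      refine Finset.disjoint_of_subset_right (Finset.subset_biUnion_of_mem id hA) ?_
      exact Finset.disjoint_insert_left.2 ⟨hcon, Finset.disjoint_of_subset_left hT
        Finset.sdiff_disjoint⟩)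
  have h1 : 0 < weight k (insert v T) := by unfold weight; split_ifs <;> norm_num
  simp at h
  omega

lemma IsMaxPacking.not_matching_nbr (hk : 1 ≤ k) (hE : ∀ e ∈ E, e.card = k)
    {V : Finset (Fin n)} {F : Finset (Finset (Fin n))} (hF : IsMaxPacking E k V F)
    {𝒯 : Finset (Finset (Fin n))} (h𝒯 : ∀ T ∈ 𝒯, T ⊆ V \ F.biUnion id)
    (h𝒯d : (𝒯 : Set (Finset (Fin n))).PairwiseDisjoint id)
    {Q : Finset (Fin n)} (hQ : Q ∈ F) (hQk : Q.card = k + 1) {S : Finset (Fin n)} (hSQ : S ⊆ Q)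
    (hS : S.card = 3) {f : Fin n → Finset (Fin n)} (hf : Set.InjOn f S) :
    ¬ ∀ v ∈ S, f v ∈ 𝒯 ∧ v ∈ nbr E (f v) := by
  classical
  intro hcon
  have hfd : ∀ v ∈ S, ∀ A ∈ F, Disjoint (f v) A := fun v hv A hA =>
    Finset.disjoint_of_subset_left (h𝒯 _ (hcon v hv).1)
      (Finset.disjoint_of_subset_right (Finset.subset_biUnion_of_mem id hA) Finset.sdiff_disjoint)
  have hnot : ∀ v ∈ S, ∀ w ∈ S, v ∉ f w := fun v hv w hw hvw =>
    Finset.disjoint_left.1 (hfd w hw Q hQ) hvw (hSQ hv)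
  have he : ∀ v ∈ S, insert v (f v) ∈ E := fun v hv => (mem_nbr.1 (hcon v hv).2).2
  have h := hF.sum_weight_le hk hE (D := {Q}) (Finset.singleton_subset_iff.2 hQ) S
    (fun v => insert v (f v))
    (fun v hv => Finset.insert_subset ((hF.1.1 Q hQ).1 (hSQ hv))
      ((h𝒯 _ (hcon v hv).1).trans Finset.sdiff_subset))
    (fun v hv => Or.inl (he v hv)) (by
      intro v hv w hw hvw
      rw [Finset.mem_coe] at hv hw
      simp only [Function.onFun, Finset.disjoint_insert_left, Finset.disjoint_insert_right,
        Finset.mem_insert, not_or]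
      exact ⟨⟨Ne.symm hvw, hnot w hw v hv⟩, hnot v hv w hw,
        h𝒯d (hcon v hv).1 (hcon w hw).1 fun h => hvw (hf hv hw h)⟩) (by
      intro v hv A hA hAD
      rw [Finset.mem_singleton] at hAD
      rw [Finset.disjoint_insert_left]
      exact ⟨Finset.disjoint_left.1 (hF.1.2 hQ hA (Ne.symm hAD)) (hSQ hv), hfd v hv A hA⟩)
  rw [Finset.sum_singleton, weight_of_card_eq_succ hQk,
    Finset.sum_congr rfl fun v hv => weight_of_card_ne (by rw [hE _ (he v hv)]; omega),
    Finset.sum_const, hS, smul_eq_mul] at h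
  omega

lemma exists_disjoint_family {α : Type*} [DecidableEq α] (W : Finset α) {j : ℕ} (hj : 0 < j)
    (t : ℕ) (hW : j * t ≤ W.card) : ∃ 𝒯 : Finset (Finset α), 𝒯.card = t ∧
      (∀ T ∈ 𝒯, T.card = j ∧ T ⊆ W) ∧ (𝒯 : Set (Finset α)).PairwiseDisjoint id := by
  induction t generalizing W with
  | zero => exact ⟨∅, by simp, by simp, by simp⟩
  | succ t ih =>
    rw [Nat.mul_succ] at hW
    obtain ⟨T, hTW, hT⟩ := Finset.exists_subset_card_eq (show j ≤ W.card by omega)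
    obtain ⟨𝒯, h1, h2, h3⟩ := ih (W \ T) (by rw [Finset.card_sdiff_of_subset hTW]; omega)
    have hd : ∀ S ∈ 𝒯, Disjoint T S := fun S hS =>
      Finset.disjoint_of_subset_right (h2 S hS).2 Finset.disjoint_sdiff
    refine ⟨insert T 𝒯, ?_, ?_, ?_⟩
    · rw [Finset.card_insert_of_notMem, h1]
      intro hmem
      have := hd T hmem
      rw [disjoint_self, Finset.bot_eq_empty] at this
      simp [this] at hT
      omega
    · intro S hS
      rcases Finset.mem_insert.1 hS with rfl | hS
      · exact ⟨hT, hTW⟩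
      · exact ⟨(h2 S hS).1, (h2 S hS).2.trans Finset.sdiff_subset⟩
    · rw [Finset.coe_insert]
      exact h3.insert fun S hS _ => hd S hS

end Packing

section AlmostTiling

variable {n k : ℕ} {E : Finset (Finset (Fin n))} {γ : ℝ}

/-- Summing the matching bound over a family of at most `n / 4` disjoint cliques. -/
lemma card_mul_le_of_no_matching {𝒯 P : Finset (Finset (Fin n))}
    {N : Finset (Fin n) → Finset (Fin n)}
    {r : ℕ} {a : ℝ} (hn : 0 < n) (hk : 3 ≤ k) (hP : ∀ Q ∈ P, Q.card = k + 1)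
    (hPd : (P : Set (Finset (Fin n))).PairwiseDisjoint id)
    (h : ∀ Q ∈ P, ∀ S ⊆ Q, S.card = r + 1 → ∀ f : Fin n → Finset (Fin n), Set.InjOn f S →
      ¬ ∀ v ∈ S, f v ∈ 𝒯 ∧ v ∈ N (f v))
    (ha : ∀ T ∈ 𝒯, a * n ≤ ((N T ∩ P.biUnion id).card : ℝ)) :
    4 * a * 𝒯.card ≤ r * (𝒯.card + (k + 1)) := by
  classical
  have h1 : ∀ T ∈ 𝒯, (N T ∩ P.biUnion id).card ≤ ∑ Q ∈ P, (N T ∩ Q).card := fun T _ => by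
    rw [Finset.inter_biUnion]
    exact Finset.card_biUnion_le
  have h2 : ∑ T ∈ 𝒯, (N T ∩ P.biUnion id).card ≤ P.card * (r * (𝒯.card + (k + 1))) := by
    refine (Finset.sum_le_sum h1).trans ?_
    rw [Finset.sum_comm, ← smul_eq_mul]
    refine Finset.sum_le_card_nsmul _ _ _ fun Q hQ => ?_
    rw [← hP Q hQ]
    exact sum_card_inter_le_of_no_matching 𝒯 Q N r (h Q hQ)
  have h3 : P.card * 4 ≤ n := by
    have h4 : (P.biUnion id).card = P.card * (k + 1) := by
      rw [Finset.card_biUnion hPd]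
      exact Finset.sum_const_nat fun Q hQ => hP Q hQ
    have h5 := Finset.card_le_univ (P.biUnion id)
    rw [h4, Fintype.card_fin] at h5
    nlinarith
  have h6 : (𝒯.card : ℝ) * (a * n) ≤ ∑ T ∈ 𝒯, ((N T ∩ P.biUnion id).card : ℝ) := by
    have := Finset.card_nsmul_le_sum 𝒯 _ _ ha
    rwa [nsmul_eq_mul] at this
  have h7 : ∑ T ∈ 𝒯, ((N T ∩ P.biUnion id).card : ℝ) ≤ P.card * (r * (𝒯.card + (k + 1))) := by
    exact_mod_cast h2
  have h8 : (P.card : ℝ) * 4 ≤ n := by exact_mod_cast h3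
  have hn' : (0 : ℝ) < n := by exact_mod_cast hn
  have h9 := mul_le_mul_of_nonneg_right h8
    (by positivity : (0 : ℝ) ≤ r * (𝒯.card + (k + 1)))
  refine le_of_mul_le_mul_right ?_ hn'
  linarith

/-- All but boundedly many vertices outside a small set can be tiled. -/
lemma Dense.exists_tiled_card_sdiff_le (hE : Dense E k γ) (hk : 3 ≤ k) (hγ : 0 ≤ γ)
    (U : Finset (Fin n)) (hU : (U.card : ℝ) ≤ 1 / 24 * n)
    (hn : 6 * (k : ℝ) * (k + 1) ≤ 1 / 24 * n) :
    ∃ A ⊆ Uᶜ, Tiled E k A ∧ (Uᶜ \ A).card ≤ (k + 1) * (9 * k) := by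
  classical
  obtain ⟨F, hF⟩ := exists_isMaxPacking E k Uᶜ
  have hk1 : 1 ≤ k := by omega
  have hk3 : (3 : ℝ) ≤ k := by exact_mod_cast hk
  have hn0 : (0 : ℝ) < n := by nlinarith
  have hn0' : 0 < n := by exact_mod_cast hn0
  set P := F.filter fun A => A.card = k + 1 with hP
  set R := F.filter fun A => A.card ≠ k + 1 with hR
  have hPF : P ⊆ F := Finset.filter_subset _ _
  have hRF : R ⊆ F := Finset.filter_subset _ _
  have hPk : ∀ Q ∈ P, Q.card = k + 1 := fun Q hQ => (Finset.mem_filter.1 hQ).2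
  have hPd : (P : Set (Finset (Fin n))).PairwiseDisjoint id :=
    hF.1.2.subset (Finset.coe_subset.2 hPF)
  have hPc : ∀ Q ∈ P, IsCliqueOn E k Q := fun Q hQ =>
    (hF.1.1 Q (hPF hQ)).2.resolve_left fun h => by
      have := hE.1 Q h
      have := hPk Q hQ
      omega
  have hRE : ∀ e ∈ R, e ∈ E := fun e he =>
    (hF.1.1 e (hRF he)).2.resolve_right fun h => (Finset.mem_filter.1 he).2 h.1
  have hUc : (23 : ℝ) / 24 * n ≤ (Uᶜ.card : ℝ) := by
    rw [Finset.card_compl, Fintype.card_fin, Nat.cast_sub (by simpa using U.card_le_univ)]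
    linarith
  have hRcard : (R.card : ℝ) ≤ 6 * (k + 1) := by
    have h1 := card_mul_le_of_no_matching (𝒯 := R) (P := P) (N := cliqueExt E k) (r := 1)
      (a := 7 / 24) hn0' hk hPk hPd
      (fun Q hQ S hSQ hS f hf => hF.not_matching_cliqueExt hk1 hE.1 (hPF hQ) (hPk Q hQ) hSQ hS hf)
      (fun e he => by
        have h2 := hE.card_sdiff_cliqueExt_le (by omega) (hRE e he) Uᶜ
        have h3 := card_sdiff_add_card_inter_real Uᶜ (cliqueExt E k e)
        have h4 : Uᶜ ∩ cliqueExt E k e ⊆ cliqueExt E k e ∩ P.biUnion id := by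
          intro v hv
          rw [Finset.mem_inter] at hv
          obtain ⟨Q, hQ, hQk, hvQ⟩ := hF.exists_mem_of_mem_cliqueExt hk1 hE.1 (hRF he)
            (Finset.mem_filter.1 he).2 hv.1 hv.2
          exact Finset.mem_inter.2 ⟨hv.2, Finset.mem_biUnion.2
            ⟨Q, Finset.mem_filter.2 ⟨hQ, hQk⟩, hvQ⟩⟩
        have h5 : ((Uᶜ ∩ cliqueExt E k e).card : ℝ) ≤
            ((cliqueExt E k e ∩ P.biUnion id).card : ℝ) := by
          exact_mod_cast Finset.card_le_card h4
        have h6 := mul_le_mul_of_nonneg_right (mul_codef_le hk hγ) hn0.le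
        linarith)
    push_cast at h1
    linarith
  have hRU : ((R.biUnion id).card : ℝ) ≤ 6 * k * (k + 1) := by
    have h1 : (R.biUnion id).card ≤ R.card * k :=
      Finset.card_biUnion_le_card_mul _ _ _ fun e he => (hE.1 e (hRE e he)).le
    have h2 : ((R.biUnion id).card : ℝ) ≤ R.card * k := by exact_mod_cast h1
    nlinarith
  have hFPR : F.biUnion id = P.biUnion id ∪ R.biUnion id := by
    rw [← Finset.union_biUnion, Finset.filter_union_filter_not_eq]
  have hW : (Uᶜ \ F.biUnion id).card ≤ (k - 1) * (3 * (k + 1)) := by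
    by_contra! hlt
    obtain ⟨𝒯, h𝒯c, h𝒯, h𝒯d⟩ := exists_disjoint_family (Uᶜ \ F.biUnion id)
      (by omega : 0 < k - 1) (3 * (k + 1)) hlt.le
    have h1 := card_mul_le_of_no_matching (𝒯 := 𝒯) (P := P) (N := nbr E) (r := 2)
      (a := 25 / 36) hn0' hk hPk hPd
      (fun Q hQ S hSQ hS f hf => hF.not_matching_nbr hk1 hE.1 (fun T hT => (h𝒯 T hT).2) h𝒯d
        (hPF hQ) (hPk Q hQ) hSQ hS hf)
      (fun T hT => by
        have h2 := hE.card_sdiff_nbr_le (by rw [(h𝒯 T hT).1]; omega) Uᶜ (T := T)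
        have h3 := card_sdiff_add_card_inter_real Uᶜ (nbr E T)
        have h4 : Uᶜ ∩ nbr E T ⊆ (nbr E T ∩ P.biUnion id) ∪ R.biUnion id := by
          intro v hv
          rw [Finset.mem_inter] at hv
          have := hF.exists_mem_of_mem_nbr hk1 hE.1 (h𝒯 T hT).2 hv.1 hv.2
          rw [hFPR, Finset.mem_union] at this
          rw [Finset.mem_union, Finset.mem_inter]
          exact this.imp (fun h => ⟨hv.2, h⟩) id
        have h5 : ((Uᶜ ∩ nbr E T).card : ℝ) ≤
            ((nbr E T ∩ P.biUnion id).card : ℝ) + (R.biUnion id).card := by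
          exact_mod_cast (Finset.card_le_card h4).trans (Finset.card_union_le _ _)
        have h6 := mul_le_mul_of_nonneg_right (codef_le hk hγ) hn0.le
        linarith)
    rw [h𝒯c] at h1
    push_cast at h1
    linarith
  refine ⟨P.biUnion id, ?_, ⟨P, hPc, hPd, rfl⟩, ?_⟩
  · exact Finset.biUnion_subset.2 fun Q hQ => (hF.1.1 Q (hPF hQ)).1
  · have h1 : Uᶜ \ P.biUnion id ⊆ (Uᶜ \ F.biUnion id) ∪ R.biUnion id := by
      intro v hv
      rw [Finset.mem_sdiff] at hv
      rw [Finset.mem_union, Finset.mem_sdiff, hFPR, Finset.mem_union]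
      tauto
    have h2 := (Finset.card_le_card h1).trans (Finset.card_union_le _ _)
    have h3 : (R.biUnion id).card ≤ 6 * k * (k + 1) := by exact_mod_cast hRU
    have h4 : (k - 1) * (3 * (k + 1)) ≤ k * (3 * (k + 1)) := Nat.mul_le_mul_right _ (by omega)
    nlinarith

end AlmostTiling

section Main

variable {n k : ℕ} {E : Finset (Finset (Fin n))} {γ : ℝ}

lemma degOn_eq_card_nbr {T : Finset (Fin n)} (hT : T.card + 1 = k) :
    degOn E k T = (nbr E T).card := by
  classical
  have h : {S : Finset (Fin n) | S.card = k - T.card ∧ Disjoint S T ∧ S ∪ T ∈ E} =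
      ((nbr E T).image fun v => ({v} : Finset (Fin n)) : Set (Finset (Fin n))) := by
    ext S
    have hk : k - T.card = 1 := by omega
    simp only [hk, Set.mem_ofPred_eq, Finset.coe_image, Set.mem_image, Finset.mem_coe, mem_nbr]
    constructor
    · rintro ⟨hS, hd, hE⟩
      obtain ⟨v, rfl⟩ := Finset.card_eq_one.1 hS
      exact ⟨v, ⟨Finset.disjoint_singleton_left.1 hd, hE⟩, rfl⟩
    · rintro ⟨v, ⟨hv, hE⟩, rfl⟩
      exact ⟨Finset.card_singleton v, Finset.disjoint_singleton_left.2 hv, hE⟩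
  unfold degOn
  rw [h, Set.ncard_coe_finset, Finset.card_image_of_injective _ Finset.singleton_injective]

lemma Dense.mono {γ' : ℝ} (h : Dense E k γ) (hγ : γ' ≤ γ) : Dense E k γ' :=
  ⟨h.1, fun T hT => (h.2 T hT).trans
    (mul_le_mul_of_nonneg_right (by unfold codef; linarith) (Nat.cast_nonneg n))⟩

lemma dense_of_le_degOn (hk : 3 ≤ k) (hE : ∀ e ∈ E, e.card = k)
    (h : ∀ T : Finset (Fin n), T.card = k - 1 →
      (1 - ((k : ℝ) + (if Odd k then 1 else 0)) / (2 * (k : ℝ) ^ 2) + γ) * n ≤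
        (degOn E k T : ℝ)) : Dense E k γ := by
  refine ⟨hE, fun T hT => ?_⟩
  have h1 := h T (by omega)
  rw [degOn_eq_card_nbr hT] at h1
  have h2 : ((nbr E T)ᶜ.card : ℝ) = n - (nbr E T).card := by
    rw [Finset.card_compl, Fintype.card_fin, Nat.cast_sub (by simpa using (nbr E T).card_le_univ)]
  have h3 : ((k : ℝ) + (if Odd k then 1 else 0)) / (2 * (k : ℝ) ^ 2) ≤
      ((k : ℝ) + 1) / (2 * (k : ℝ) ^ 2) := by
    gcongr
    split_ifs <;> norm_num
  have h4 := mul_le_mul_of_nonneg_right h3 (Nat.cast_nonneg (α := ℝ) n)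
  unfold codef
  linarith

lemma exists_forall_tiled_univ (hk : 3 ≤ k) (hγ : 0 < γ) (hγ' : γ ≤ 1 / 12) :
    ∃ N : ℕ, ∀ n : ℕ, N ≤ n → k + 1 ∣ n → ∀ E : Finset (Finset (Fin n)), Dense E k γ →
      Tiled E k Finset.univ := by
  classical
  obtain ⟨N, hN⟩ := exists_forall_exists_absorbing_bounded hk hγ hγ' (9 * k) (1 / 24) (by norm_num)
  obtain ⟨N', hN'⟩ := exists_forall_le_mul (6 * (k : ℝ) * (k + 1)) (by norm_num : (0 : ℝ) < 1 / 24)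
  refine ⟨N + N', fun n hn hdvd E hE => ?_⟩
  obtain ⟨U, hUc, hU, hUW⟩ := hN n (by omega) E hE
  obtain ⟨A, hAU, hA, hAc⟩ := hE.exists_tiled_card_sdiff_le hk hγ.le U hUc (hN' n (by omega))
  have hcard : (Uᶜ \ A).card = n - U.card - A.card := by
    rw [Finset.card_sdiff_of_subset hAU, Finset.card_compl, Fintype.card_fin]
  have h := hUW (Uᶜ \ A)
    (hcard ▸ Nat.dvd_sub (Nat.dvd_sub hdvd hU.card_dvd) hA.card_dvd) hAc
    (Finset.disjoint_of_subset_right Finset.sdiff_subset disjoint_compl_right)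
  have h' := h.union hA (Finset.disjoint_union_left.2
    ⟨Finset.disjoint_of_subset_right hAU disjoint_compl_right, Finset.sdiff_disjoint⟩)
  convert h' using 1
  ext v
  simp only [Finset.mem_univ, Finset.mem_union, Finset.mem_sdiff, Finset.mem_compl, true_iff]
  tauto

end Main

end CliqueFactor

/-- Upper bound for the codegree threshold for `K_{k+1}^k`-factors. -/
theorem Kk_plus_one_factor (k : ℕ) (hk : 3 ≤ k) (γ : ℝ) (hγ : 0 < γ) :
    ∃ n₀ : ℕ, ∀ n : ℕ, n₀ ≤ n → (k + 1) ∣ n →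
      ∀ E : Finset (Finset (Fin n)), (∀ e ∈ E, e.card = k) →
      (∀ T : Finset (Fin n), T.card = k - 1 →
        (1 - ((k : ℝ) + (if Odd k then 1 else 0)) / (2 * (k : ℝ) ^ 2) + γ) * n ≤
          (degOn E k T : ℝ)) →
      HasFactorOn E (cliqueEdges (k + 1) k) (Finset.univ : Finset (Fin n)) := by
  have hδ : 0 < min γ (1 / 12) := lt_min hγ (by norm_num)
  obtain ⟨N, hN⟩ := CliqueFactor.exists_forall_tiled_univ hk hδ (min_le_right _ _)
  exact ⟨N, fun n hn hdvd E hE hdeg => (hN n hn hdvd E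
    ((CliqueFactor.dense_of_le_degOn hk hE hdeg).mono (min_le_left _ _))).hasFactorOn⟩
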